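/- arXiv:0810.4867 — 3 statements merged into one kernel-verified Lean document; each statement's English description precedes it below -/
import Mathlib

section
/- Let 𝔾 be a right-angled Artin group. Centralisers in 𝔾 are isolated: for all x, g ∈ 𝔾 and every nonzero integer n, if x^n commutes with g then x commutes with g. Equivalently, C(g) = C(√g) for every nontrivial g, where √g is the least root of g. -/
/-- The defining relators of the right-angled Artin group on a simple graph `Γ`:
one commutator relator `[a,b] = a b a⁻¹ b⁻¹` for each edge `{a,b}` of `Γ`. -/
def raagRels {A : Type*} (Γ : SimpleGraph A) : Set (FreeGroup A) :=
  {r | ∃ a b : A, Γ.Adj a b ∧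
    r = FreeGroup.of a * FreeGroup.of b * (FreeGroup.of a)⁻¹ * (FreeGroup.of b)⁻¹}

/-- The right-angled Artin group (partially commutative group) `𝔾(Γ)` on a simple
graph `Γ`. -/
abbrev RAAG {A : Type*} (Γ : SimpleGraph A) :=
  PresentedGroup (raagRels Γ)

/-- The canonical generator of `𝔾(Γ)` corresponding to a vertex `a`. -/
def raagGen {A : Type*} (Γ : SimpleGraph A) (a : A) : RAAG Γ :=
  PresentedGroup.of a

namespace RaagAux

variable {A : Type} (Γ : SimpleGraph A)

/-- Finitely supported-in-length functions on words, invariant under commutations, zero on squares. -/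
def V : Submodule ℚ (List A → ℚ) where
  carrier := {f | (∀ a b, Γ.Adj a b → ∀ u v, f (u ++ a :: b :: v) = f (u ++ b :: a :: v)) ∧
    (∀ a u v, f (u ++ a :: a :: v) = 0) ∧ ∃ N : ℕ, ∀ w : List A, N ≤ w.length → f w = 0}
  add_mem' := by
    rintro f g ⟨h1, h2, N, h3⟩ ⟨k1, k2, M, k3⟩
    refine ⟨fun a b hab u v => ?_, fun a u v => ?_, max N M, fun w hw => ?_⟩
    · simp only [Pi.add_apply, h1 a b hab, k1 a b hab]
    · simp only [Pi.add_apply, h2, k2, add_zero]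
    · simp only [Pi.add_apply, h3 w (le_trans (le_max_left _ _) hw),
        k3 w (le_trans (le_max_right _ _) hw), add_zero]
  zero_mem' := ⟨fun _ _ _ _ _ => rfl, fun _ _ _ => rfl, 0, fun _ _ => rfl⟩
  smul_mem' := by
    rintro c f ⟨h1, h2, N, h3⟩
    refine ⟨fun a b hab u v => ?_, fun a u v => ?_, N, fun w hw => ?_⟩
    · simp only [Pi.smul_apply, h1 a b hab]
    · simp only [Pi.smul_apply, h2, smul_zero]
    · simp only [Pi.smul_apply, h3 w hw, smul_zero]

def W : Type := V Γ
instance : AddCommGroup (W Γ) := inferInstanceAs (AddCommGroup (V Γ))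
instance : Module ℚ (W Γ) := inferInstanceAs (Module ℚ (V Γ))

abbrev E := Module.End ℚ (W Γ)

def X (a : A) : E Γ where
  toFun f := ⟨fun w => f.1 (w ++ [a]), by
    obtain ⟨f, h1, h2, N, h3⟩ := f
    refine ⟨fun c b hab u v => ?_, fun c u v => ?_, N, fun w hw => ?_⟩
    · simpa using h1 c b hab u (v ++ [a])
    · simpa using h2 c u (v ++ [a])
    · exact h3 _ (by simp; omega)⟩
  map_add' f g := rfl
  map_smul' c f := rfl

lemma X_apply (a : A) (f : W Γ) (w : List A) : (X Γ a f).1 w = f.1 (w ++ [a]) := rfl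

lemma X_sq (a : A) : X Γ a * X Γ a = 0 := by
  refine LinearMap.ext fun f => Subtype.ext (funext fun w => ?_)
  change f.1 ((w ++ [a]) ++ [a]) = 0
  simpa using f.2.2.1 a w []

lemma X_comm {a b : A} (h : Γ.Adj a b) : X Γ a * X Γ b = X Γ b * X Γ a := by
  refine LinearMap.ext fun f => Subtype.ext (funext fun w => ?_)
  change f.1 ((w ++ [a]) ++ [b]) = f.1 ((w ++ [b]) ++ [a])
  simpa using f.2.1 a b h w []

def U (a : A) : (E Γ)ˣ where
  val := 1 + X Γ a
  inv := 1 - X Γ a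
  val_inv := by
    have := X_sq Γ a
    calc (1 + X Γ a) * (1 - X Γ a) = 1 - X Γ a * X Γ a := by noncomm_ring
      _ = 1 := by rw [this, sub_zero]
  inv_val := by
    have := X_sq Γ a
    calc (1 - X Γ a) * (1 + X Γ a) = 1 - X Γ a * X Γ a := by noncomm_ring
      _ = 1 := by rw [this, sub_zero]

lemma U_zpow (a : A) (e : ℤ) : ((U Γ a ^ e : (E Γ)ˣ) : E Γ) = 1 + (e : ℚ) • X Γ a := by
  have hs := X_sq Γ a
  induction e using Int.induction_on with
  | zero => simp
  | succ n ih =>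
    rw [zpow_add_one, Units.val_mul, ih]
    change _ * (1 + X Γ a) = _
    rw [add_mul, one_mul, mul_add, mul_one, smul_mul_assoc, hs]
    push_cast
    module
  | pred n ih =>
    rw [zpow_sub_one, Units.val_mul, ih]
    change _ * (1 - X Γ a) = _
    rw [add_mul, one_mul, mul_sub, mul_one, smul_mul_assoc, hs]
    push_cast
    module

def phi : RAAG Γ →* (E Γ)ˣ := PresentedGroup.toGroup (f := U Γ) (by
  rintro r ⟨a, b, hab, rfl⟩
  have h : U Γ a * U Γ b = U Γ b * U Γ a := by
    ext1
    change (1 + X Γ a) * (1 + X Γ b) = (1 + X Γ b) * (1 + X Γ a)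
    have := X_comm Γ hab
    simp only [add_mul, mul_add, one_mul, mul_one, this]
    abel
  simp [h])

lemma phi_gen (a : A) : phi Γ (raagGen Γ a) = U Γ a := PresentedGroup.toGroup.of _

def val (L : List (A × ℤ)) : RAAG Γ := (L.map fun p => raagGen Γ p.1 ^ p.2).prod

lemma val_nil : val Γ [] = 1 := rfl
lemma val_cons (p : A × ℤ) (L) : val Γ (p :: L) = raagGen Γ p.1 ^ p.2 * val Γ L := by
  simp [val]
lemma val_append (L M) : val Γ (L ++ M) = val Γ L * val Γ M := by simp [val]

lemma exists_val (x : RAAG Γ) : ∃ L, val Γ L = x := by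
  obtain ⟨y, rfl⟩ := PresentedGroup.mk_surjective (raagRels Γ) x
  induction y using FreeGroup.induction_on with
  | C1 => exact ⟨[], by simp [val_nil]⟩
  | of a => exact ⟨[(a, 1)], by simp [val]; rfl⟩
  | inv_of a _ => exact ⟨[(a, -1)], by simp [val]; rfl⟩
  | mul x y hx hy =>
    obtain ⟨L, hL⟩ := hx
    obtain ⟨M, hM⟩ := hy
    exact ⟨L ++ M, by rw [val_append, hL, hM, map_mul]⟩

lemma phi_cons (p : A × ℤ) (L) : ((phi Γ (val Γ (p :: L))).1 : E Γ) =
    (1 + (p.2 : ℚ) • X Γ p.1) * (phi Γ (val Γ L)).1 := by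
  rw [val_cons, map_mul, map_zpow, phi_gen, Units.val_mul, U_zpow]

/-- Filtration on endomorphisms. -/
def J (k : ℕ) : Submodule ℚ (E Γ) where
  carrier := {T | ∀ (N : ℕ) (f : W Γ), (∀ w : List A, N ≤ w.length → f.1 w = 0) →
    ∀ w : List A, N ≤ w.length + k → (T f).1 w = 0}
  add_mem' := by
    intro S T hS hT N f hf w hw
    have h1 := hS N f hf w hw
    have h2 := hT N f hf w hw
    change (S f).1 w + (T f).1 w = 0
    rw [h1, h2, add_zero]
  zero_mem' := fun _ _ _ _ _ => rfl
  smul_mem' := by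
    intro c S hS N f hf w hw
    have h1 := hS N f hf w hw
    change c * (S f).1 w = 0
    rw [h1, mul_zero]

lemma J_mul {k l : ℕ} {S T : E Γ} (hS : S ∈ J Γ k) (hT : T ∈ J Γ l) : S * T ∈ J Γ (k + l) := by
  intro N f hf w hw
  exact hS (N - l) (T f) (fun w hw => hT N f hf w (by omega)) w (by omega)

lemma J_anti {k l : ℕ} (h : k ≤ l) : J Γ l ≤ J Γ k :=
  fun _ hT N f hf w hw => hT N f hf w (by omega)

lemma J_one : (1 : E Γ) ∈ J Γ 0 := fun _ _ hf w hw => hf w hw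

lemma J_X (a : A) : X Γ a ∈ J Γ 1 := fun _ _ hf w hw => hf _ (by simpa using hw)

lemma J_inf {T : E Γ} (h : ∀ k, T ∈ J Γ k) : T = 0 := by
  refine LinearMap.ext fun f => Subtype.ext (funext fun w => ?_)
  obtain ⟨N, hN⟩ := f.2.2.2
  exact h N N f hN w (by omega)

lemma unip_mul {S T : E Γ} (hS : S - 1 ∈ J Γ 1) (hT : T - 1 ∈ J Γ 1) : S * T - 1 ∈ J Γ 1 := by
  have : S * T - 1 = (S - 1) * (T - 1) + (S - 1) + (T - 1) := by noncomm_ring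
  rw [this]
  exact add_mem (add_mem (J_anti Γ (by omega) (J_mul Γ hS hT)) hS) hT

lemma phi_unip (x : RAAG Γ) : (phi Γ x).1 - 1 ∈ J Γ 1 := by
  obtain ⟨L, rfl⟩ := exists_val Γ x
  induction L with
  | nil => simp [val_nil]
  | cons p L ih =>
    rw [phi_cons]
    refine unip_mul Γ ?_ ih
    rw [add_sub_cancel_left]
    exact (J Γ 1).smul_mem _ (J_X Γ _)

lemma unip_pow {S : E Γ} (hS : S - 1 ∈ J Γ 1) (n : ℕ) : S ^ n - 1 ∈ J Γ 1 := by
  induction n with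
  | zero => simp
  | succ n ih => rw [pow_succ]; exact unip_mul Γ ih hS

lemma pow_diff {u v : E Γ} (hu : u - 1 ∈ J Γ 1) (hv : v - 1 ∈ J Γ 1) {k : ℕ}
    (h : u - v ∈ J Γ k) (n : ℕ) : u ^ n - v ^ n - (n : ℚ) • (u - v) ∈ J Γ (k + 1) := by
  induction n with
  | zero => simp
  | succ n ih =>
    have h1 : u ^ n - v ^ n ∈ J Γ k := by
      have := add_mem (J_anti Γ (Nat.le_succ k) ih) ((J Γ k).smul_mem (n : ℚ) h)
      simpa using this
    have h2 := J_mul Γ hu h1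
    have h3 := J_mul Γ h (unip_pow Γ hv n)
    rw [add_comm 1 k] at h2
    have : u ^ (n+1) - v ^ (n+1) - ((n + 1 : ℕ) : ℚ) • (u - v) =
        (u ^ n - v ^ n - (n : ℚ) • (u - v)) + (u - 1) * (u ^ n - v ^ n)
          + (u - v) * (v ^ n - 1) := by
      rw [pow_succ', pow_succ']
      push_cast
      rw [add_smul, one_smul]
      noncomm_ring
    rw [this]
    exact add_mem (add_mem ih h2) h3

lemma root_unique {u v : E Γ} (hu : u - 1 ∈ J Γ 1) (hv : v - 1 ∈ J Γ 1) {n : ℕ} (hn : n ≠ 0)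
    (h : u ^ n = v ^ n) : u = v := by
  rw [← sub_eq_zero]
  refine J_inf Γ fun k => ?_
  induction k with
  | zero =>
    have := sub_mem hu hv
    rw [sub_sub_sub_cancel_right] at this
    exact J_anti Γ (by omega) this
  | succ k ih =>
    have := pow_diff Γ hu hv ih n
    rw [h, sub_self, zero_sub] at this
    have := (J Γ (k+1)).smul_mem (-(n : ℚ)⁻¹) this
    have hn' : (n : ℚ) ≠ 0 := by exact_mod_cast hn
    rwa [smul_neg, neg_smul, neg_neg, smul_smul, inv_mul_cancel₀ hn', one_smul] at this

/-- Elementary swap. -/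
def Sw (w w' : List A) : Prop :=
  ∃ a b u v, Γ.Adj a b ∧ w = u ++ a :: b :: v ∧ w' = u ++ b :: a :: v

lemma Sw_symm {w w' : List A} (h : Sw Γ w w') : Sw Γ w' w := by
  obtain ⟨a, b, u, v, h, h1, h2⟩ := h
  exact ⟨b, a, u, v, h.symm, h2, h1⟩

abbrev Eq' := Relation.ReflTransGen (Sw Γ)

lemma eq_len {w w' : List A} (h : Eq' Γ w w') : w'.length = w.length := by
  induction h with
  | refl => rfl
  | tail _ h ih =>
    obtain ⟨a, b, u, v, h, h1, h2⟩ := h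
    subst h1 h2
    rw [← ih]; simp

lemma gen_comm {a b : A} (h : Γ.Adj a b) : Commute (raagGen Γ a) (raagGen Γ b) := by
  have : (PresentedGroup.mk (raagRels Γ) (FreeGroup.of a * FreeGroup.of b * (FreeGroup.of a)⁻¹ *
      (FreeGroup.of b)⁻¹)) = 1 := PresentedGroup.one_of_mem ⟨a, b, h, rfl⟩
  simp only [map_mul, map_inv] at this
  change raagGen Γ a * raagGen Γ b * (raagGen Γ a)⁻¹ * (raagGen Γ b)⁻¹ = 1 at this
  rw [mul_inv_eq_one, mul_inv_eq_iff_eq_mul] at this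
  exact this

lemma lift_eq {L : List (A × ℤ)} {w : List A} (h : Eq' Γ (L.map Prod.fst) w) :
    ∃ L', L'.map Prod.fst = w ∧ val Γ L' = val Γ L := by
  induction h with
  | refl => exact ⟨L, rfl, rfl⟩
  | tail _ h ih =>
    obtain ⟨L', h1, h2⟩ := ih
    obtain ⟨a, b, u, v, hab, rfl, rfl⟩ := h
    obtain ⟨P, Q, rfl, rfl, hQ⟩ := List.map_eq_append_iff.1 h1
    obtain ⟨⟨p, e⟩, Q1, rfl, rfl, hQ1⟩ := List.map_eq_cons_iff.1 hQ
    obtain ⟨⟨q, d⟩, Q, rfl, rfl, rfl⟩ := List.map_eq_cons_iff.1 hQ1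
    refine ⟨P ++ (q, d) :: (p, e) :: Q, by simp, ?_⟩
    rw [← h2]
    simp only [val_append, val_cons]
    rw [← mul_assoc (_ ^ d), ← mul_assoc (_ ^ e),
      (((gen_comm Γ hab).zpow_left e).zpow_right d).eq]

lemma eval (k : ℕ) (f : W Γ) (hf : ∀ w : List A, w.length ≠ k → f.1 w = 0) (L : List (A × ℤ)) :
    (∀ w : List A, w.length + L.length < k → ((phi Γ (val Γ L)).1 f).1 w = 0) ∧
    (∀ w : List A, w.length + L.length = k → ((phi Γ (val Γ L)).1 f).1 w =
      (L.map fun p => (p.2 : ℚ)).prod * f.1 (w ++ L.map Prod.fst)) := by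
  induction L with
  | nil =>
    rw [val_nil, map_one]
    refine ⟨fun w hw => hf w (by simp at hw; omega), fun w hw => ?_⟩
    simp
  | cons p L ih =>
    have key : ∀ w, ((phi Γ (val Γ (p :: L))).1 f).1 w = ((phi Γ (val Γ L)).1 f).1 w +
        (p.2 : ℚ) * ((phi Γ (val Γ L)).1 f).1 (w ++ [p.1]) := by
      intro w
      rw [phi_cons]
      rfl
    refine ⟨fun w hw => ?_, fun w hw => ?_⟩ <;> simp only [List.length_cons] at hw
    · rw [key, ih.1 w (by omega), ih.1 _ (by simp; omega)]; simp
    · rw [key, ih.1 w (by omega), ih.2 _ (by simp; omega)]; simp [mul_assoc]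

lemma phi_inj (x : RAAG Γ) (hx : phi Γ x = 1) : x = 1 := by
  classical
  by_contra hne
  have hex : ∃ k L, L.length = k ∧ val Γ L = x := by
    obtain ⟨L, hL⟩ := exists_val Γ x
    exact ⟨_, L, rfl, hL⟩
  obtain ⟨L, hlen, hval⟩ := Nat.find_spec hex
  have hmin : ∀ L', val Γ L' = x → L.length ≤ L'.length := by
    intro L' h
    rw [hlen]
    exact Nat.find_min' hex ⟨L', rfl, h⟩
  clear hlen
  have hsq : ∀ a u v, ¬ Eq' Γ (L.map Prod.fst) (u ++ a :: a :: v) := by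
    intro a u v h
    have hl := eq_len Γ h
    obtain ⟨L', h1, h2⟩ := lift_eq Γ h
    obtain ⟨P, Q, rfl, rfl, hQ⟩ := List.map_eq_append_iff.1 h1
    obtain ⟨⟨_, e⟩, Q1, rfl, rfl, hQ1⟩ := List.map_eq_cons_iff.1 hQ
    obtain ⟨⟨b, d⟩, Q, rfl, hb, rfl⟩ := List.map_eq_cons_iff.1 hQ1
    simp only at hb
    subst hb
    have := hmin (P ++ (b, e + d) :: Q) (by
      rw [← hval, ← h2]
      simp only [val_append, val_cons, zpow_add, mul_assoc])
    simp at this hl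
    omega
  have hnz : ∀ p ∈ L, p.2 ≠ 0 := by
    intro p hp h0
    obtain ⟨P, Q, rfl⟩ := List.append_of_mem hp
    have := hmin (P ++ Q) (by
      rw [← hval]
      simp [val_append, val_cons, h0])
    simp at this
  let f : W Γ := ⟨fun w => if Eq' Γ (L.map Prod.fst) w then 1 else 0, by
    refine ⟨fun a b hab u v => ?_, fun a u v => ?_, L.length + 1, fun w hw => ?_⟩
    · have : Eq' Γ (L.map Prod.fst) (u ++ a :: b :: v) ↔
          Eq' Γ (L.map Prod.fst) (u ++ b :: a :: v) :=
        ⟨fun h => h.tail ⟨a, b, u, v, hab, rfl, rfl⟩,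
          fun h => h.tail ⟨b, a, u, v, hab.symm, rfl, rfl⟩⟩
      simp only [this]
    · exact if_neg (hsq a u v)
    · refine if_neg fun h => ?_
      have := eq_len Γ h
      simp at this
      omega⟩
  have hf : ∀ w : List A, w.length ≠ L.length → f.1 w = 0 := fun w hw =>
    if_neg fun h => hw (by simpa using eq_len Γ h)
  have hL : L.length ≠ 0 := by
    intro h
    rw [List.length_eq_zero_iff] at h
    subst h
    exact hne (by rw [← hval, val_nil])
  have h := (eval Γ L.length f hf L).2 [] (by simp)
  rw [hval, hx] at h
  have h0 : f.1 [] = 0 := hf [] (by simpa using hL.symm)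
  have h1 : f.1 ([] ++ L.map Prod.fst) = 1 := if_pos Relation.ReflTransGen.refl
  rw [h1, mul_one] at h
  change f.1 [] = _ at h
  rw [h0] at h
  have := List.prod_eq_zero_iff.1 h.symm
  simp only [List.mem_map] at this
  obtain ⟨p, hp, hp0⟩ := this
  exact hnz p hp (by exact_mod_cast hp0)

end RaagAux

/-- Centralisers in a RAAG are isolated: if a nonzero power `x^n` commutes with `g`,
then `x` commutes with `g`. -/
theorem raag_centralizer_isolated {A : Type} [Fintype A] (Γ : SimpleGraph A)
    (x g : RAAG Γ) (n : ℤ) (hn : n ≠ 0) (h : Commute (x ^ n) g) :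
    Commute x g := by
  have h' : Commute (x ^ n.natAbs) g := by
    rcases Int.natAbs_eq n with hh | hh
    · rw [hh, zpow_natCast] at h
      exact h
    · rw [hh, zpow_neg, zpow_natCast] at h
      exact Commute.inv_left_iff.1 h
  have h2 : (g * x * g⁻¹) ^ n.natAbs = x ^ n.natAbs := by
    rw [conj_pow, ← h'.eq, mul_inv_cancel_right]
  have h3 : RaagAux.phi Γ (g * x * g⁻¹) = RaagAux.phi Γ x := by
    ext1
    refine RaagAux.root_unique Γ (RaagAux.phi_unip Γ _) (RaagAux.phi_unip Γ _)
      (Int.natAbs_ne_zero.2 hn) ?_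
    have := congrArg (fun y => (RaagAux.phi Γ y).1) h2
    simpa only [map_pow, Units.val_pow_eq_pow_val] using this
  have h4 := RaagAux.phi_inj Γ ((g * x * g⁻¹) * x⁻¹) (by
    rw [map_mul, h3, ← map_mul, mul_inv_cancel, map_one])
  rw [mul_inv_eq_one, mul_inv_eq_iff_eq_mul] at h4
  exact h4.symm
end

section
/- (Centraliser Theorem for RAAGs) Let 𝔾 = 𝔾(Γ) be a right-angled Artin group and let w ∈ 𝔾 be a cyclically reduced element with block decomposition w = v_1 ⋯ v_k. Then the centraliser of w is C(w) = ⟨√v_1⟩ × ⋯ × ⟨√v_k⟩ × 𝔸(w), where √v_i is the least root of v_i and 𝔸(w) is the subgroup of 𝔾 generated by all generators a ∈ A that do not occur in a geodesic word representing w and commute with w. -/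
/-- The canonical projection `F(A) → 𝔾(Γ)`. -/
def raagMk {A : Type*} (Γ : SimpleGraph A) : FreeGroup A →* RAAG Γ :=
  PresentedGroup.mk (raagRels Γ)

/-- The length of `g ∈ 𝔾(Γ)`: the minimal length of a word in the generators and their
inverses representing `g` (the length of a geodesic representative of `g`). -/
noncomputable def raagLen {A : Type*} (Γ : SimpleGraph A) (g : RAAG Γ) : ℕ :=
  sInf {m | ∃ l : List (A × Bool), l.length = m ∧ raagMk Γ (FreeGroup.mk l) = g}

/-- The support `α(g)` of `g ∈ 𝔾(Γ)`: the set of generators occurring in a geodesic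
word representing `g` (this set does not depend on the choice of geodesic). -/
def raagSupp {A : Type*} (Γ : SimpleGraph A) (g : RAAG Γ) : Set A :=
  {a | ∃ l : List (A × Bool), raagMk Γ (FreeGroup.mk l) = g ∧
        l.length = raagLen Γ g ∧ a ∈ l.map Prod.fst}

/-- `g` is cyclically reduced if `|g²| = 2|g|`. -/
def CyclicallyReduced {A : Type*} (Γ : SimpleGraph A) (g : RAAG Γ) : Prop :=
  raagLen Γ (g * g) = 2 * raagLen Γ g

/-- `g` is a block if the full subgraph of the non-commutation graph `Δ = Γᶜ` on the
support `α(g)` is connected. -/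
def IsBlock {A : Type*} (Γ : SimpleGraph A) (g : RAAG Γ) : Prop :=
  ((Γᶜ).induce (raagSupp Γ g)).Connected


namespace RG
open Classical

variable {A : Type} {Γ : SimpleGraph A}

/-- inverse letter -/
def iv (x : A × Bool) : A × Bool := (x.1, !x.2)

@[simp] theorem iv_fst (x : A × Bool) : (iv x).1 = x.1 := rfl
@[simp] theorem iv_iv (x : A × Bool) : iv (iv x) = x := by simp [iv]

/-- projection of a word to the letters with names in `S` -/
noncomputable def proj (S : Set A) (l : List (A × Bool)) : List (A × Bool) :=
  l.filter (fun x => decide (x.1 ∈ S))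

@[simp] theorem proj_nil (S : Set A) : proj S [] = [] := rfl
@[simp] theorem proj_append (S : Set A) (l m : List (A × Bool)) :
    proj S (l ++ m) = proj S l ++ proj S m := by simp [proj]
theorem proj_cons_mem {S : Set A} {x : A × Bool} (h : x.1 ∈ S) (l : List (A × Bool)) :
    proj S (x :: l) = x :: proj S l := by simp [proj, h]
theorem proj_cons_not {S : Set A} {x : A × Bool} (h : x.1 ∉ S) (l : List (A × Bool)) :
    proj S (x :: l) = proj S l := by simp [proj, h]
@[simp] theorem mem_proj {S : Set A} {x : A × Bool} {l : List (A × Bool)} :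
    x ∈ proj S l ↔ x ∈ l ∧ x.1 ∈ S := by simp [proj]
theorem proj_comm (S T : Set A) (l : List (A × Bool)) :
    proj S (proj T l) = proj T (proj S l) := by
  simp only [proj, List.filter_filter]
  congr 1; ext x; exact Bool.and_comm _ _
theorem proj_eq_nil {S : Set A} {l : List (A × Bool)} (h : ∀ x ∈ l, x.1 ∉ S) :
    proj S l = [] := by
  simp only [proj, List.filter_eq_nil_iff]
  intro x hx; simpa using h x hx
theorem proj_eq_self {S : Set A} {l : List (A × Bool)} (h : ∀ x ∈ l, x.1 ∈ S) :
    proj S l = l := by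
  simp only [proj, List.filter_eq_self]
  intro x hx; simpa using h x hx

/-- trace equivalence -/
def Eqv (Γ : SimpleGraph A) (l m : List (A × Bool)) : Prop :=
  ∀ a b, ¬ Γ.Adj a b → proj {a, b} l = proj {a, b} m

theorem Eqv.refl (l : List (A × Bool)) : Eqv Γ l l := fun _ _ _ => rfl
theorem Eqv.symm {l m : List (A × Bool)} (h : Eqv Γ l m) : Eqv Γ m l :=
  fun a b c => (h a b c).symm
theorem Eqv.trans {l m n : List (A × Bool)} (h : Eqv Γ l m) (h' : Eqv Γ m n) : Eqv Γ l n :=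
  fun a b c => (h a b c).trans (h' a b c)
theorem Eqv.append {l m l' m' : List (A × Bool)} (h : Eqv Γ l m) (h' : Eqv Γ l' m') :
    Eqv Γ (l ++ l') (m ++ m') := fun a b c => by
  rw [proj_append, proj_append, h a b c, h' a b c]
theorem Eqv.cons (x : A × Bool) {l m : List (A × Bool)} (h : Eqv Γ l m) :
    Eqv Γ (x :: l) (x :: m) := Eqv.append (Eqv.refl [x]) h
theorem Eqv.cancel_left {l m n : List (A × Bool)} (h : Eqv Γ (l ++ m) (l ++ n)) : Eqv Γ m n :=
  fun a b c => by
    have := h a b c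
    rw [proj_append, proj_append] at this
    exact List.append_cancel_left this
theorem Eqv.cons_cancel {x : A × Bool} {m n : List (A × Bool)}
    (h : Eqv Γ (x :: m) (x :: n)) : Eqv Γ m n :=
  Eqv.cancel_left (l := [x]) h
theorem Eqv.proj {l m : List (A × Bool)} (S : Set A) (h : Eqv Γ l m) :
    Eqv Γ (proj S l) (proj S m) := fun a b c => by
  rw [proj_comm, h a b c, proj_comm]

/-- all letters of `p` commute with `x` -/
def Com (Γ : SimpleGraph A) (p : List (A × Bool)) (x : A × Bool) : Prop :=
  ∀ y ∈ p, Γ.Adj y.1 x.1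

theorem Com.not_mem {p : List (A × Bool)} {x y : A × Bool} (h : Com Γ p x) (hy : y ∈ p)
    (e : y.1 = x.1) : False := by
  have := h y hy
  rw [e] at this
  exact Γ.irrefl this

theorem swap {p : List (A × Bool)} {x : A × Bool} (h : Com Γ p x) (q : List (A × Bool)) :
    Eqv Γ (p ++ x :: q) (x :: (p ++ q)) := by
  intro a b hab
  by_cases hx : x.1 ∈ ({a, b} : Set A)
  · have : RG.proj {a, b} p = [] := by
      apply proj_eq_nil
      intro y hy hy'
      have := h y hy
      rcases hx with hx | hx <;> rcases hy' with hy' | hy' <;> rw [hx, hy'] at this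
      · exact Γ.irrefl this
      · exact hab this.symm
      · exact hab this
      · exact Γ.irrefl this
    rw [proj_append, proj_cons_mem hx, proj_cons_mem hx, proj_append, this]; rfl
  · rw [proj_append, proj_cons_not hx, proj_cons_not hx, proj_append]

theorem first_occ (a : A) (m : List (A × Bool)) (h : ∃ x ∈ m, x.1 = a) :
    ∃ p y q, m = p ++ y :: q ∧ y.1 = a ∧ ∀ z ∈ p, z.1 ≠ a := by
  induction m with
  | nil => simp at h
  | cons z m ih =>
    by_cases hz : z.1 = a
    · exact ⟨[], z, m, rfl, hz, by simp⟩
    · obtain ⟨x, hx, hxa⟩ := h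
      have hx' : x ∈ m := by
        rcases List.mem_cons.1 hx with rfl | h
        · exact absurd hxa hz
        · exact h
      obtain ⟨p, y, q, rfl, hy, hp⟩ := ih ⟨x, hx', hxa⟩
      refine ⟨z :: p, y, q, rfl, hy, ?_⟩
      intro u hu
      rcases List.mem_cons.1 hu with rfl | h
      · exact hz
      · exact hp u h

theorem head {x : A × Bool} {l m : List (A × Bool)} (h : Eqv Γ (x :: l) m) :
    ∃ p q, m = p ++ x :: q ∧ Com Γ p x ∧ Eqv Γ l (p ++ q) := by
  have h1 := h x.1 x.1 (Γ.irrefl)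
  rw [proj_cons_mem (by simp)] at h1
  have hx : x ∈ RG.proj {x.1, x.1} m := by rw [← h1]; simp
  obtain ⟨p, y, q, rfl, hy, hp⟩ := first_occ x.1 m ⟨x, (mem_proj.1 hx).1, rfl⟩
  have : RG.proj {x.1, x.1} p = [] := proj_eq_nil (by intro z hz; simpa using hp z hz)
  rw [proj_append, this, proj_cons_mem (by simp [hy])] at h1
  have hxy : x = y := by simpa using (List.cons.inj h1).1
  subst hxy
  have hc : Com Γ p x := by
    intro z hz
    by_contra hadj
    have h2 := h z.1 x.1 hadj
    rw [proj_cons_mem (by simp), proj_append] at h2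
    have hz2 : z ∈ RG.proj {z.1, x.1} p := by simp [hz]
    cases hpp : RG.proj {z.1, x.1} p with
    | nil => rw [hpp] at hz2; simp at hz2
    | cons u t =>
      rw [hpp] at h2
      have e : x = u := (List.cons.inj h2).1
      have : u ∈ RG.proj {z.1, x.1} p := by rw [hpp]; simp
      exact hp u (mem_proj.1 this).1 (by rw [e])
  exact ⟨p, q, rfl, hc, Eqv.cons_cancel (h.trans (swap hc q))⟩

theorem head2 {x y : A × Bool} {l m : List (A × Bool)} (h : Eqv Γ (x :: l) (y :: m))
    (hne : x ≠ y) : ∃ n, Eqv Γ l (y :: n) ∧ Eqv Γ m (x :: n) := by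
  obtain ⟨p, q, e, hc, hl⟩ := head h
  cases p with
  | nil => exact absurd (List.cons.inj e).1.symm hne
  | cons z p =>
    obtain ⟨rfl, rfl⟩ := List.cons.inj e
    exact ⟨p ++ q, hl, swap (fun u hu => hc u (List.mem_cons_of_mem _ hu)) q⟩

/-! ### evaluation -/

/-- the group element of a word -/
def E (Γ : SimpleGraph A) (l : List (A × Bool)) : RAAG Γ := raagMk Γ (FreeGroup.mk l)

@[simp] theorem E_nil : E Γ [] = 1 := by
  unfold E; rw [← FreeGroup.one_eq_mk, map_one]
theorem E_append (l m : List (A × Bool)) : E Γ (l ++ m) = E Γ l * E Γ m := by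
  unfold E; rw [← FreeGroup.mul_mk, map_mul]
theorem E_cons (x : A × Bool) (m : List (A × Bool)) : E Γ (x :: m) = E Γ [x] * E Γ m :=
  E_append [x] m
theorem E_iv (x : A × Bool) : E Γ [iv x] = (E Γ [x])⁻¹ := by
  unfold E; rw [← map_inv, FreeGroup.inv_mk]; rfl
theorem E_true (a : A) : E Γ [(a, true)] = raagGen Γ a := rfl
theorem E_false (a : A) : E Γ [(a, false)] = (raagGen Γ a)⁻¹ := E_iv (a, true)
theorem E_surj (g : RAAG Γ) : ∃ l, E Γ l = g := by
  obtain ⟨f, rfl⟩ := QuotientGroup.mk_surjective g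
  exact ⟨f.toWord, by unfold E; rw [FreeGroup.mk_toWord]; rfl⟩

theorem gen_comm {a b : A} (h : Γ.Adj a b) : Commute (raagGen Γ a) (raagGen Γ b) := by
  have : raagMk Γ (FreeGroup.of a * FreeGroup.of b * (FreeGroup.of a)⁻¹ * (FreeGroup.of b)⁻¹) = 1 :=
    PresentedGroup.one_of_mem ⟨a, b, h, rfl⟩
  rw [map_mul, map_mul, map_mul, map_inv, map_inv] at this
  rw [mul_inv_eq_one, mul_inv_eq_iff_eq_mul] at this
  exact this

theorem letter_comm {x y : A × Bool} (h : Γ.Adj x.1 y.1) : Commute (E Γ [x]) (E Γ [y]) := by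
  obtain ⟨a, s⟩ := x
  obtain ⟨b, t⟩ := y
  have := gen_comm h
  cases s <;> cases t <;> simp only [E_true, E_false] <;> simpa using this

theorem com_comm {p : List (A × Bool)} {x : A × Bool} (h : Com Γ p x) :
    Commute (E Γ p) (E Γ [x]) := by
  induction p with
  | nil => simp
  | cons y p ih =>
    rw [E_cons]
    exact (letter_comm (h y (by simp))).mul_left (ih fun z hz => h z (by simp [hz]))

theorem Eqv.perm_E {l m : List (A × Bool)} (h : Eqv Γ l m) : l.Perm m ∧ E Γ l = E Γ m := by
  induction l generalizing m with
  | nil =>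
    cases m with
    | nil => simp
    | cons y m =>
      have := h y.1 y.1 Γ.irrefl
      rw [proj_cons_mem (by simp)] at this
      simp at this
  | cons x l ih =>
    obtain ⟨p, q, rfl, hc, hl⟩ := head h
    obtain ⟨h1, h2⟩ := ih hl
    refine ⟨(h1.cons x).trans List.perm_middle.symm, ?_⟩
    rw [E_cons, h2, E_append, E_append, E_cons x q, ← mul_assoc, ← mul_assoc, (com_comm hc).eq]

theorem Eqv.perm {l m : List (A × Bool)} (h : Eqv Γ l m) : l.Perm m := h.perm_E.1
theorem Eqv.E_eq {l m : List (A × Bool)} (h : Eqv Γ l m) : E Γ l = E Γ m := h.perm_E.2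

/-! ### reduced words -/

def Red (Γ : SimpleGraph A) (l : List (A × Bool)) : Prop :=
  ¬ ∃ p x m, Eqv Γ l (p ++ x :: iv x :: m)

theorem Red.eqv {l m : List (A × Bool)} (h : Red Γ l) (e : Eqv Γ l m) : Red Γ m :=
  fun ⟨p, x, n, h'⟩ => h ⟨p, x, n, e.trans h'⟩
theorem Red.right {l m : List (A × Bool)} (h : Red Γ (l ++ m)) : Red Γ m :=
  fun ⟨p, x, n, h'⟩ => h ⟨l ++ p, x, n, by
    rw [List.append_assoc]; exact (Eqv.refl l).append h'⟩
theorem Red.left {l m : List (A × Bool)} (h : Red Γ (l ++ m)) : Red Γ l :=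
  fun ⟨p, x, n, h'⟩ => h ⟨p, x, n ++ m, by
    simpa using h'.append (Eqv.refl m)⟩
theorem Red.tail {x : A × Bool} {m : List (A × Bool)} (h : Red Γ (x :: m)) : Red Γ m :=
  Red.right (l := [x]) h

/-- `x` cancels on the left of `l` -/
def Canc (Γ : SimpleGraph A) (x : A × Bool) (l : List (A × Bool)) : Prop :=
  ∃ m, Eqv Γ l (iv x :: m)

theorem red_nil : Red Γ [] := by
  rintro ⟨p, x, m, h⟩
  have := h.perm.length_eq
  simp at this

theorem red_cons {x : A × Bool} {l : List (A × Bool)} (h : Red Γ l) (hc : ¬ Canc Γ x l) :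
    Red Γ (x :: l) := by
  rintro ⟨p, y, m, he⟩
  obtain ⟨p', q', e, hcom, hl⟩ := head he
  rcases List.append_eq_append_iff.1 e with ⟨t, rfl, ht⟩ | ⟨t, rfl, ht⟩
  · -- p' = p ++ t
    cases t with
    | nil =>
      simp only [List.nil_append, List.cons.injEq] at ht
      obtain ⟨rfl, rfl⟩ := ht
      apply hc
      refine ⟨p ++ m, hl.trans ?_⟩
      simp only [List.append_nil] at hcom ⊢
      exact swap (x := iv y) hcom m
    | cons z t =>
      simp only [List.cons_append, List.cons.injEq] at ht
      obtain ⟨rfl, ht⟩ := ht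
      cases t with
      | nil =>
        simp only [List.nil_append, List.cons.injEq] at ht
        obtain ⟨rfl, rfl⟩ := ht
        exact hcom.not_mem (y := y) (by simp) rfl
      | cons z t =>
        simp only [List.cons_append, List.cons.injEq] at ht
        obtain ⟨rfl, rfl⟩ := ht
        exact h ⟨p, y, t ++ q', by simpa using hl⟩
  · cases t with
    | nil =>
      simp only [List.nil_append, List.cons.injEq] at ht
      obtain ⟨rfl, rfl⟩ := ht
      apply hc
      refine ⟨p' ++ m, hl.trans ?_⟩
      exact swap (x := iv x) hcom m
    | cons z t =>
      simp only [List.cons_append, List.cons.injEq] at ht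
      obtain ⟨rfl, rfl⟩ := ht
      exact h ⟨p' ++ t, y, m, by simpa using hl⟩

theorem red_not_canc {x : A × Bool} {l : List (A × Bool)} (h : Red Γ (x :: l)) : ¬ Canc Γ x l :=
  fun ⟨m, hm⟩ => h ⟨[], x, m, hm.cons x⟩

noncomputable def push (Γ : SimpleGraph A) (x : A × Bool) (l : List (A × Bool)) :
    List (A × Bool) :=
  if h : Canc Γ x l then h.choose else x :: l

theorem push_canc {x : A × Bool} {l : List (A × Bool)} (h : Canc Γ x l) :
    Eqv Γ l (iv x :: push Γ x l) := by
  unfold push; rw [dif_pos h]; exact h.choose_spec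
theorem push_not {x : A × Bool} {l : List (A × Bool)} (h : ¬ Canc Γ x l) :
    push Γ x l = x :: l := by
  unfold push; rw [dif_neg h]
theorem push_eq {x : A × Bool} {l m : List (A × Bool)} (h : Eqv Γ l (iv x :: m)) :
    Eqv Γ (push Γ x l) m :=
  Eqv.cons_cancel ((push_canc ⟨m, h⟩).symm.trans h)
theorem Canc.eqv {x : A × Bool} {l m : List (A × Bool)} (h : Canc Γ x l) (e : Eqv Γ l m) :
    Canc Γ x m := h.imp fun _ h => e.symm.trans h

theorem push_eqv {x : A × Bool} {l m : List (A × Bool)} (e : Eqv Γ l m) :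
    Eqv Γ (push Γ x l) (push Γ x m) := by
  by_cases h : Canc Γ x l
  · exact push_eq (e.trans (push_canc (h.eqv e)))
  · rw [push_not h, push_not fun h' => h (h'.eqv e.symm)]; exact e.cons x

theorem push_red {x : A × Bool} {l : List (A × Bool)} (h : Red Γ l) : Red Γ (push Γ x l) := by
  by_cases hc : Canc Γ x l
  · exact (h.eqv (push_canc hc)).tail
  · rw [push_not hc]; exact red_cons h hc

theorem push_push {x y : A × Bool} (hxy : y = iv x) {l : List (A × Bool)} (h : Red Γ l) :
    Eqv Γ (push Γ x (push Γ y l)) l := by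
  subst hxy
  by_cases hc : Canc Γ (iv x) l
  · have h1 := push_canc hc
    rw [iv_iv] at h1
    rw [push_not (red_not_canc (h.eqv h1))]
    exact h1.symm
  · rw [push_not hc]
    exact push_eq (Eqv.refl _)

theorem swap2 {x y : A × Bool} (h : Γ.Adj x.1 y.1) (l : List (A × Bool)) :
    Eqv Γ (x :: y :: l) (y :: x :: l) :=
  swap (p := [x]) (x := y) (by intro z hz; rw [List.mem_singleton.1 hz]; exact h) l

theorem push_comm_aux {x y : A × Bool} (hxy : Γ.Adj x.1 y.1) {l : List (A × Bool)}
    (hx : Canc Γ x l) (hy : ¬ Canc Γ y l) :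
    Eqv Γ (push Γ x (push Γ y l)) (push Γ y (push Γ x l)) := by
  have h1 := push_canc hx
  rw [push_not hy]
  have : ¬ Canc Γ y (push Γ x l) := by
    rintro ⟨m, hm⟩
    exact hy ⟨_, h1.trans ((hm.cons _).trans (swap2 (by simpa using hxy) m))⟩
  rw [push_not this]
  exact push_eq ((h1.cons y).trans (swap2 (by simpa using hxy.symm) _))

theorem push_comm {x y : A × Bool} (hxy : Γ.Adj x.1 y.1) (l : List (A × Bool)) :
    Eqv Γ (push Γ x (push Γ y l)) (push Γ y (push Γ x l)) := by
  by_cases hx : Canc Γ x l <;> by_cases hy : Canc Γ y l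
  · have h1 := push_canc hx
    have h2 := push_canc hy
    have hne : iv x ≠ iv y := by
      intro e
      have : x.1 = y.1 := by simpa using congrArg Prod.fst e
      rw [this] at hxy
      exact Γ.irrefl hxy
    obtain ⟨n, hn1, hn2⟩ := head2 (h1.symm.trans h2) hne
    exact (push_eq hn2).trans (push_eq hn1).symm
  · exact push_comm_aux hxy hx hy
  · exact (push_comm_aux hxy.symm hy hx).symm
  · have hne : ∀ u v : A × Bool, Γ.Adj u.1 v.1 → v ≠ iv u := by
      intro u v h e
      rw [e] at h
      exact Γ.irrefl h
    have key : ∀ u v : A × Bool, Γ.Adj u.1 v.1 → ¬ Canc Γ u l → ¬ Canc Γ u (v :: l) := by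
      rintro u v h hu ⟨m, hm⟩
      obtain ⟨n, hn, -⟩ := head2 hm (hne u v h)
      exact hu ⟨n, hn⟩
    rw [push_not hx, push_not hy, push_not (key x y hxy hx), push_not (key y x hxy.symm hy)]
    exact swap2 hxy l

/-! ### the action on reduced traces -/

def tsetoid (Γ : SimpleGraph A) : Setoid {l : List (A × Bool) // Red Γ l} where
  r l m := Eqv Γ l.1 m.1
  iseqv := ⟨fun _ => Eqv.refl _, fun h => h.symm, fun h h' => h.trans h'⟩

def Tr (Γ : SimpleGraph A) := Quotient (tsetoid Γ)

def Tr.mk {l : List (A × Bool)} (h : Red Γ l) : Tr Γ := Quotient.mk (tsetoid Γ) ⟨l, h⟩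

theorem Tr.mk_eq {l m : List (A × Bool)} (h : Red Γ l) (h' : Red Γ m) :
    Tr.mk h = Tr.mk h' ↔ Eqv Γ l m := Quotient.eq (r := tsetoid Γ)

noncomputable def act (x : A × Bool) : Tr Γ → Tr Γ :=
  Quotient.lift (s := tsetoid Γ) (fun l => Tr.mk (push_red (x := x) l.2))
    (fun _ _ h => (Tr.mk_eq _ _).2 (push_eqv h))

theorem act_mk (x : A × Bool) {l : List (A × Bool)} (h : Red Γ l) :
    act x (Tr.mk h) = Tr.mk (push_red (x := x) h) := rfl

theorem Tr.ind {P : Tr Γ → Prop} (h : ∀ l (hl : Red Γ l), P (Tr.mk hl)) (t : Tr Γ) : P t :=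
  Quotient.ind (s := tsetoid Γ) (fun l => h l.1 l.2) t

theorem act_act {x y : A × Bool} (hxy : y = iv x) (t : Tr Γ) : act x (act y t) = t := by
  induction t using Tr.ind with
  | h l hl => rw [act_mk, act_mk, Tr.mk_eq]; exact push_push hxy hl

theorem act_comm {x y : A × Bool} (hxy : Γ.Adj x.1 y.1) (t : Tr Γ) :
    act x (act y t) = act y (act x t) := by
  induction t using Tr.ind with
  | h l hl => rw [act_mk, act_mk, act_mk, act_mk, Tr.mk_eq]; exact push_comm hxy l

noncomputable def actE (Γ : SimpleGraph A) (a : A) : Equiv.Perm (Tr Γ) where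
  toFun := act (a, true)
  invFun := act (a, false)
  left_inv t := act_act rfl t
  right_inv t := act_act rfl t

noncomputable def Phi (Γ : SimpleGraph A) : RAAG Γ →* Equiv.Perm (Tr Γ) :=
  PresentedGroup.toGroup (f := actE Γ) (by
    rintro r ⟨a, b, hab, rfl⟩
    simp only [map_mul, map_inv, FreeGroup.lift_apply_of]
    rw [mul_inv_eq_one, mul_inv_eq_iff_eq_mul]
    ext t
    exact act_comm (x := (a, true)) (y := (b, true)) hab t)

theorem Phi_letter (x : A × Bool) (t : Tr Γ) : Phi Γ (E Γ [x]) t = act x t := by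
  have h : ∀ a, Phi Γ (raagGen Γ a) = actE Γ a := fun a => PresentedGroup.toGroup.of _
  obtain ⟨a, s⟩ := x
  cases s
  · rw [E_false, map_inv, h]; rfl
  · rw [E_true, h]; rfl

theorem Phi_red {l : List (A × Bool)} (h : Red Γ l) :
    Phi Γ (E Γ l) (Tr.mk red_nil) = Tr.mk h := by
  induction l with
  | nil => rw [E_nil, map_one]; rfl
  | cons x l ih =>
    rw [E_cons, map_mul, Equiv.Perm.mul_apply, ih h.tail, Phi_letter, act_mk, Tr.mk_eq,
      push_not (red_not_canc h)]
    exact Eqv.refl _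

theorem red_unique {l m : List (A × Bool)} (h : Red Γ l) (h' : Red Γ m) (e : E Γ l = E Γ m) :
    Eqv Γ l m := by
  rw [← Tr.mk_eq h h', ← Phi_red h, ← Phi_red h', e]

/-! ### length -/

theorem len_le (l : List (A × Bool)) : raagLen Γ (E Γ l) ≤ l.length :=
  Nat.sInf_le ⟨l, rfl, rfl⟩

theorem exists_geod (g : RAAG Γ) : ∃ l, E Γ l = g ∧ l.length = raagLen Γ g := by
  obtain ⟨l, hl⟩ := E_surj g
  have : raagLen Γ g ∈ {m | ∃ l : List (A × Bool), l.length = m ∧ raagMk Γ (FreeGroup.mk l) = g} :=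
    Nat.sInf_mem ⟨_, l, rfl, hl⟩
  obtain ⟨m, h1, h2⟩ := this
  exact ⟨m, h2, h1⟩

theorem geod_red {l : List (A × Bool)} (h : l.length = raagLen Γ (E Γ l)) : Red Γ l := by
  rintro ⟨p, x, m, he⟩
  have e : E Γ l = E Γ (p ++ m) := by
    rw [he.E_eq, E_append, E_cons, E_cons (iv x), E_iv, mul_inv_cancel_left, E_append]
  have := len_le (Γ := Γ) (p ++ m)
  rw [← e, ← h, he.perm.length_eq] at this
  simp at this

theorem red_geod {l : List (A × Bool)} (h : Red Γ l) : raagLen Γ (E Γ l) = l.length := by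
  obtain ⟨m, h1, h2⟩ := exists_geod (E Γ l)
  have := red_unique h (geod_red (l := m) (by rw [h1, h2])) h1.symm
  rw [this.perm.length_eq, h2]

theorem exists_red (g : RAAG Γ) : ∃ l, E Γ l = g ∧ Red Γ l := by
  obtain ⟨m, h1, h2⟩ := exists_geod g
  exact ⟨m, h1, geod_red (by rw [h1, h2])⟩

theorem len_mul (g h : RAAG Γ) : raagLen Γ (g * h) ≤ raagLen Γ g + raagLen Γ h := by
  obtain ⟨l, rfl, h2⟩ := exists_geod g
  obtain ⟨m, rfl, h3⟩ := exists_geod h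
  rw [← E_append, ← h2, ← h3, ← List.length_append]
  exact len_le _

theorem len_of_mul (g h : RAAG Γ) : raagLen Γ h ≤ raagLen Γ g⁻¹ + raagLen Γ (g * h) := by
  simpa using len_mul g⁻¹ (g * h)

theorem supp_eq {l : List (A × Bool)} (h : Red Γ l) :
    raagSupp Γ (E Γ l) = {a | ∃ x ∈ l, x.1 = a} := by
  ext a
  constructor
  · rintro ⟨m, h1, h2, h3⟩
    have h1' : E Γ m = E Γ l := h1
    have := red_unique h (geod_red (l := m) (by rw [h1', h2])) h1'.symm
    obtain ⟨x, hx, rfl⟩ := List.mem_map.1 h3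
    exact ⟨x, this.perm.mem_iff.2 hx, rfl⟩
  · rintro ⟨x, hx, rfl⟩
    exact ⟨l, rfl, (red_geod h).symm, List.mem_map_of_mem hx⟩

theorem straddle {l m : List (A × Bool)} (hl : Red Γ l) (hm : Red Γ m) (h : ¬ Red Γ (l ++ m)) :
    ∃ l1 x l2 p q, l = l1 ++ x :: l2 ∧ m = p ++ iv x :: q ∧ Com Γ l2 x ∧ Com Γ p x := by
  induction l with
  | nil => exact absurd hm h
  | cons x l ih =>
    by_cases hr : Red Γ (l ++ m)
    · have hc : Canc Γ x (l ++ m) := by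
        by_contra hc
        exact h (red_cons hr hc)
      obtain ⟨n, hn⟩ := hc
      obtain ⟨p, q, e, hcom, -⟩ := head hn.symm
      have hcom' : Com Γ p x := hcom
      have hnc := red_not_canc hl
      rcases List.append_eq_append_iff.1 e with ⟨t, rfl, ht⟩ | ⟨t, rfl, ht⟩
      · exact ⟨[], x, l, t, q, rfl, ht, fun y hy => hcom y (by simp [hy]),
          fun y hy => hcom y (by simp [hy])⟩
      · cases t with
        | nil =>
          simp only [List.nil_append] at ht
          exact ⟨[], x, p, [], q, by simp, by simpa using ht.symm, hcom', by intro y hy; simp at hy⟩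
        | cons z t =>
          simp only [List.cons_append, List.cons.injEq] at ht
          obtain ⟨rfl, rfl⟩ := ht
          exact absurd ⟨p ++ t, swap (x := iv x) hcom t⟩ hnc
    · obtain ⟨l1, y, l2, p, q, rfl, rfl, h1, h2⟩ := ih hl.tail hr
      exact ⟨x :: l1, y, l2, p, q, rfl, rfl, h1, h2⟩

/-! ### powers of words -/

def rep : ℕ → List (A × Bool) → List (A × Bool)
  | 0, _ => []
  | n + 1, l => l ++ rep n l

@[simp] theorem rep_zero (l : List (A × Bool)) : rep 0 l = [] := rfl
theorem rep_succ (n : ℕ) (l : List (A × Bool)) : rep (n + 1) l = l ++ rep n l := rfl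

theorem E_rep (n : ℕ) (l : List (A × Bool)) : E Γ (rep n l) = E Γ l ^ n := by
  induction n with
  | zero => simp
  | succ n ih => rw [rep_succ, E_append, ih, pow_succ']

theorem proj_rep (S : Set A) (n : ℕ) (l : List (A × Bool)) :
    proj S (rep n l) = rep n (proj S l) := by
  induction n with
  | zero => simp
  | succ n ih => rw [rep_succ, proj_append, ih, rep_succ]

@[simp] theorem rep_length (n : ℕ) (l : List (A × Bool)) : (rep n l).length = n * l.length := by
  induction n with
  | zero => simp
  | succ n ih => rw [rep_succ, List.length_append, ih]; ring

theorem mem_rep {n : ℕ} {l : List (A × Bool)} {x : A × Bool} (h : x ∈ rep n l) : x ∈ l := by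
  induction n with
  | zero => simp at h
  | succ n ih =>
    rw [rep_succ, List.mem_append] at h
    exact h.elim id ih

theorem mem_rep_of {n : ℕ} {l : List (A × Bool)} {x : A × Bool} (h : x ∈ l) (hn : n ≠ 0) :
    x ∈ rep n l := by
  obtain ⟨m, rfl⟩ := Nat.exists_eq_succ_of_ne_zero hn
  rw [Nat.succ_eq_add_one, rep_succ]; simp [h]

theorem rep_comm1 {u v : List (A × Bool)} (h : u ++ v = v ++ u) (n : ℕ) :
    u ++ rep n v = rep n v ++ u := by
  induction n with
  | zero => simp
  | succ n ih =>
    rw [rep_succ, ← List.append_assoc, h, List.append_assoc, ih, List.append_assoc]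

theorem rep_eq {u v : List (A × Bool)} (h : u ++ v = v ++ u) :
    rep v.length u = rep u.length v := by
  have h1 := rep_comm1 h u.length
  have h2 := rep_comm1 h1.symm v.length
  exact (List.append_inj h2 (by simp [mul_comm])).1.symm

theorem word_unique {u u' v : List (A × Bool)} (h : u ++ v = v ++ u) (h' : u' ++ v = v ++ u')
    (hl : u.length = u'.length) (hv : v ≠ []) : u = u' := by
  have h1 := rep_eq h
  have h2 := rep_eq h'
  rw [← hl, ← h1] at h2
  obtain ⟨m, hm⟩ := Nat.exists_eq_succ_of_ne_zero (mt List.length_eq_zero_iff.1 hv)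
  rw [hm, Nat.succ_eq_add_one, rep_succ, rep_succ] at h2
  exact (List.append_inj h2 hl.symm).1.symm

theorem red_rep {l : List (A × Bool)} (h : Red Γ (l ++ l)) (n : ℕ) : Red Γ (rep n l) := by
  induction n with
  | zero => exact red_nil
  | succ n ih =>
    by_contra hc
    rw [rep_succ] at hc
    obtain ⟨l1, x, l2, p, q, e1, e2, c1, c2⟩ := straddle h.left ih hc
    have hxl : x ∈ l := by rw [e1]; simp
    have hxp : x ∉ p := fun hx => c2.not_mem hx rfl
    have hl : ∃ s, l = p ++ iv x :: s := by
      cases n with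
      | zero => simp at e2
      | succ n =>
        rw [rep_succ] at e2
        rcases List.append_eq_append_iff.1 e2 with ⟨t, rfl, ht⟩ | ⟨t, ht1, ht⟩
        · exact absurd (List.mem_append_left _ hxl) hxp
        · cases t with
          | nil => rw [ht1] at hxl; simp at hxl; exact absurd hxl hxp
          | cons z t =>
            simp only [List.cons_append, List.cons.injEq] at ht
            exact ⟨t, by rw [ht1, ht.1]⟩
    obtain ⟨s, hs⟩ := hl
    apply h
    refine ⟨l1 ++ l2 ++ p, x, s, ?_⟩
    have h1 : Eqv Γ (l1 ++ x :: l2 ++ (p ++ iv x :: s)) (l1 ++ l2 ++ p ++ x :: iv x :: s) := by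
      have hc : Com Γ (l2 ++ p) x := by
        intro y hy
        rcases List.mem_append.1 hy with hy | hy
        · exact c1 y hy
        · exact c2 y hy
      have := (Eqv.refl (Γ := Γ) l1).append (swap hc (iv x :: s)).symm
      simpa using this
    have : l ++ l = l1 ++ x :: l2 ++ (p ++ iv x :: s) := by rw [← e1, ← hs]
    rw [this]; exact h1

theorem torsion_free_aux (n : ℕ) (hn : n ≠ 0) (L : ℕ) : ∀ g : RAAG Γ, raagLen Γ g ≤ L →
    g ^ n = 1 → g = 1 := by
  induction L with
  | zero =>
    intro g hg _
    obtain ⟨l, rfl, h⟩ := exists_geod g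
    have : l = [] := List.length_eq_zero_iff.1 (by omega)
    rw [this]; simp
  | succ L ih =>
    intro g hg hgn
    obtain ⟨l, rfl, hl⟩ := exists_red g
    by_cases hr : Red Γ (l ++ l)
    · have h1 := red_unique (red_rep hr n) red_nil (by rw [E_rep, hgn, E_nil])
      have h2 := h1.perm.length_eq
      simp [hn] at h2
      rw [h2]; simp
    · obtain ⟨l1, x, l2, p, q, e1, e2, c1, c2⟩ := straddle hl hl hr
      have hxp : x ∉ p := fun hx => c2.not_mem hx rfl
      have hxx : iv x ≠ x := fun h => by
        have := congrArg Prod.snd h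
        simp [iv] at this
      have : ∃ t, l = p ++ iv x :: t ++ x :: l2 := by
        have e := e1.symm.trans e2
        rcases List.append_eq_append_iff.1 e with ⟨t, rfl, ht⟩ | ⟨t, rfl, ht⟩
        · cases t with
          | nil => simp at ht; exact absurd ht.1.symm hxx
          | cons z t =>
            simp only [List.cons_append, List.cons.injEq] at ht
            rw [← ht.1] at hxp; simp at hxp
        · cases t with
          | nil => simp at ht; exact absurd ht.1 hxx
          | cons z t =>
            simp only [List.cons_append, List.cons.injEq] at ht
            exact ⟨t, by rw [e1, ht.1]⟩
      obtain ⟨t, ht⟩ := this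
      have key : E Γ l = (E Γ [x])⁻¹ * E Γ (p ++ t ++ l2) * E Γ [x] := by
        have h1 := com_comm c1
        have h2 := (com_comm c2).inv_right
        rw [ht]
        simp only [E_append]
        rw [E_cons (iv x), E_cons x l2, E_iv]
        rw [← h1.eq]
        simp only [← mul_assoc]
        rw [← h2.eq]
      have hlen : raagLen Γ (E Γ (p ++ t ++ l2)) ≤ L := by
        have h1 := len_le (Γ := Γ) (p ++ t ++ l2)
        rw [red_geod hl, ht] at hg
        simp only [List.length_append, List.length_cons] at h1 hg
        omega
      have h3 : E Γ (p ++ t ++ l2) = 1 := by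
        apply ih _ hlen
        have : E Γ (p ++ t ++ l2) = E Γ [x] * E Γ l * (E Γ [x])⁻¹ := by rw [key]; group
        rw [this, conj_pow, hgn]; simp
      rw [key, h3]; simp

theorem torsion_free {g : RAAG Γ} {n : ℤ} (hn : n ≠ 0) (h : g ^ n = 1) : g = 1 := by
  refine torsion_free_aux n.natAbs (by omega) _ g le_rfl ?_
  rcases Int.natAbs_eq n with e | e
  · rw [e] at h; simpa using h
  · rw [e] at h; simpa using h

/-! ### growth -/

theorem growth {l : List (A × Bool)} (hl : Red Γ (l ++ l)) {g : RAAG Γ}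
    (hg : Commute g (E Γ l)) : ∃ (N : ℕ) (h : List (A × Bool)), E Γ h = g * E Γ l ^ N ∧
      Eqv Γ (h ++ l) (l ++ h) := by
  have hex : ∃ N : ℕ, raagLen Γ (g * E Γ l ^ N) + l.length ≤ raagLen Γ (g * E Γ l ^ (N + 1)) := by
    by_contra hc
    push Not at hc
    have h1 : ∀ N : ℕ, raagLen Γ (g * E Γ l ^ N) + N ≤ raagLen Γ g + N * l.length := by
      intro N
      induction N with
      | zero => simp
      | succ N ih =>
        have := hc N
        rw [Nat.succ_mul]
        omega
    have h2 := h1 (raagLen Γ g + raagLen Γ g⁻¹ + 1)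
    have h3 := len_of_mul g (E Γ l ^ (raagLen Γ g + raagLen Γ g⁻¹ + 1))
    rw [← E_rep, red_geod (red_rep hl _), rep_length, E_rep] at h3
    omega
  obtain ⟨N, hN⟩ := hex
  obtain ⟨h, h1, h2⟩ := exists_geod (g * E Γ l ^ N)
  have e1 : E Γ (h ++ l) = g * E Γ l ^ (N + 1) := by
    rw [E_append, h1, pow_succ, mul_assoc]
  have e2 : E Γ (l ++ h) = g * E Γ l ^ (N + 1) := by
    rw [E_append, h1, pow_succ', ← mul_assoc, ← mul_assoc, hg.eq]
  refine ⟨N, h, h1, red_unique (geod_red ?_) (geod_red ?_) (e1.trans e2.symm)⟩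
  · apply le_antisymm
    · rw [e1, List.length_append, h2]; exact hN
    · exact len_le _
  · apply le_antisymm
    · rw [e2, List.length_append, h2, add_comm]; exact hN
    · exact len_le _

theorem letters_adj {h l : List (A × Bool)} (hc : Eqv Γ (h ++ l) (l ++ h)) {x y : A × Bool}
    (hx : x ∈ h) (hxl : ∀ z ∈ l, z.1 ≠ x.1) (hy : y ∈ l) : Γ.Adj y.1 x.1 := by
  by_contra hadj
  have h1 := hc y.1 x.1 hadj
  rw [proj_append, proj_append] at h1
  have h2 := rep_eq h1
  have hx' : x ∈ proj {y.1, x.1} h := by simp [hx]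
  have hy' : y ∈ proj {y.1, x.1} l := by simp [hy]
  have h3 : x ∈ rep (proj {y.1, x.1} l).length (proj {y.1, x.1} h) :=
    mem_rep_of hx' (by intro e; rw [List.length_eq_zero_iff.1 e] at hy'; simp at hy')
  rw [h2] at h3
  exact hxl x (mem_proj.1 (mem_rep h3)).1 rfl

theorem split_aux (S : Set A) {h : List (A × Bool)}
    (hh : ∀ x ∈ h, ∀ y ∈ h, x.1 ∈ S → y.1 ∉ S → Γ.Adj x.1 y.1) :
    Eqv Γ h (proj S h ++ proj Sᶜ h) := by
  induction h with
  | nil => exact Eqv.refl _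
  | cons x h ih =>
    have := ih fun x hx y hy => hh x (by simp [hx]) y (by simp [hy])
    by_cases hx : x.1 ∈ S
    · rw [proj_cons_mem hx, proj_cons_not (by simpa using hx)]
      exact this.cons x
    · rw [proj_cons_not hx, proj_cons_mem (by simpa using hx)]
      refine (this.cons x).trans (swap ?_ _).symm
      intro y hy
      rw [mem_proj] at hy
      exact hh y (by simp [hy.1]) x (by simp) hy.2 hx

/-! ### counting -/

noncomputable def cnt (a : A) (l : List (A × Bool)) : ℕ := l.countP (fun x => decide (x.1 = a))

@[simp] theorem cnt_append (a : A) (l m : List (A × Bool)) :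
    cnt a (l ++ m) = cnt a l + cnt a m := by simp [cnt]
@[simp] theorem cnt_nil (a : A) : cnt a [] = 0 := rfl
@[simp] theorem cnt_rep (a : A) (n : ℕ) (l : List (A × Bool)) : cnt a (rep n l) = n * cnt a l := by
  induction n with
  | zero => simp
  | succ n ih => rw [rep_succ, cnt_append, ih]; ring
theorem cnt_proj {a : A} {T : Set A} (h : a ∈ T) (l : List (A × Bool)) :
    cnt a (proj T l) = cnt a l := by
  unfold cnt proj
  rw [List.countP_filter]
  congr 1; ext x
  by_cases hx : x.1 = a
  · simp [hx, h]
  · simp [hx]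
theorem cnt_pos {a : A} {l : List (A × Bool)} : 0 < cnt a l ↔ ∃ x ∈ l, x.1 = a := by
  simp [cnt, List.countP_pos_iff]

theorem length_pair {a b : A} (hab : a ≠ b) (l : List (A × Bool)) :
    (proj {a, b} l).length = cnt a l + cnt b l := by
  induction l with
  | nil => rfl
  | cons x l ih =>
    simp [proj, cnt] at ih
    by_cases h1 : x.1 = a
    · have : x.1 ≠ b := h1 ▸ hab
      simp [proj, cnt, h1, hab, ih]; omega
    · by_cases h2 : x.1 = b
      · simp [proj, cnt, h2, hab.symm, ih]; omega
      · simp [proj, cnt, h1, h2, ih]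

theorem length_same (a : A) (l : List (A × Bool)) :
    (proj {a, a} l).length = cnt a l := by
  unfold proj cnt; rw [List.countP_eq_length_filter]; simp

theorem cnt_prop {h l : List (A × Bool)} (hc : Eqv Γ (h ++ l) (l ++ h)) {a b : A}
    (hab : ¬ Γ.Adj a b) : cnt a h * cnt b l = cnt b h * cnt a l := by
  by_cases e : a = b
  · subst e; rfl
  have h1 := hc a b hab
  rw [proj_append, proj_append] at h1
  have h2 := congrArg (cnt a) (rep_eq h1)
  rw [cnt_rep, cnt_rep, length_pair e, length_pair e, cnt_proj (by simp), cnt_proj (by simp)] at h2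
  nlinarith

theorem cnt_prop_conn {S : Set A} {h l : List (A × Bool)} (hc : Eqv Γ (h ++ l) (l ++ h))
    (hS : ∀ a ∈ S, 0 < cnt a l) (hconn : ((Γᶜ).induce S).Preconnected) (a b : S) :
    cnt a.1 h * cnt b.1 l = cnt b.1 h * cnt a.1 l := by
  obtain ⟨p⟩ := hconn a b
  induction p with
  | nil => rfl
  | @cons u v w huv p ih =>
    have hadj : ¬ Γ.Adj u.1 v.1 := by
      have : Γᶜ.Adj u.1 v.1 := huv
      rw [SimpleGraph.compl_adj] at this
      exact this.2
    have h1 := cnt_prop hc hadj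
    have h2 := hS v.1 v.2
    apply Nat.eq_of_mul_eq_mul_right h2
    calc cnt u.1 h * cnt w.1 l * cnt v.1 l = (cnt u.1 h * cnt v.1 l) * cnt w.1 l := by ring
      _ = (cnt v.1 h * cnt w.1 l) * cnt u.1 l := by rw [h1]; ring
      _ = cnt w.1 h * cnt u.1 l * cnt v.1 l := by rw [ih]; ring

/-! ### the commuting monoid of a block -/

structure MM (Γ : SimpleGraph A) (S : Set A) (l h : List (A × Bool)) : Prop where
  names : ∀ x ∈ h, x.1 ∈ S
  comm : Eqv Γ (h ++ l) (l ++ h)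

theorem MM.append {S : Set A} {l h h' : List (A × Bool)} (H : MM Γ S l h) (H' : MM Γ S l h') :
    MM Γ S l (h ++ h') := by
  refine ⟨fun x hx => ?_, ?_⟩
  · rcases List.mem_append.1 hx with hx | hx
    · exact H.names x hx
    · exact H'.names x hx
  · have h1 := (Eqv.refl (Γ := Γ) h).append H'.comm
    have h2 := H.comm.append (Eqv.refl (Γ := Γ) h')
    simp only [List.append_assoc] at h1 h2 ⊢
    exact h1.trans h2

theorem MM.nil (S : Set A) (l : List (A × Bool)) : MM Γ S l [] :=
  ⟨by simp, by simpa using Eqv.refl l⟩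

theorem MM.rep {S : Set A} {l h : List (A × Bool)} (H : MM Γ S l h) (n : ℕ) :
    MM Γ S l (rep n h) := by
  induction n with
  | zero => exact MM.nil S l
  | succ n ih => exact H.append ih

theorem MM.unique {S : Set A} {l h h' : List (A × Bool)} (H : MM Γ S l h) (H' : MM Γ S l h')
    (hS : ∀ a ∈ S, 0 < cnt a l) (hconn : ((Γᶜ).induce S).Preconnected) {a₀ : A} (h0 : a₀ ∈ S)
    (e : cnt a₀ h = cnt a₀ h') : Eqv Γ h h' := by
  have hz : ∀ {u}, MM Γ S l u → ∀ a ∉ S, cnt a u = 0 := by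
    intro u hu a ha
    by_contra hc
    obtain ⟨x, hx, rfl⟩ := cnt_pos.1 (Nat.pos_of_ne_zero hc)
    exact ha (hu.names x hx)
  have hcnt : ∀ a, cnt a h = cnt a h' := by
    intro a
    by_cases ha : a ∈ S
    · have h1 := cnt_prop_conn H.comm hS hconn ⟨a, ha⟩ ⟨a₀, h0⟩
      have h2 := cnt_prop_conn H'.comm hS hconn ⟨a, ha⟩ ⟨a₀, h0⟩
      simp only at h1 h2
      rw [e, ← h2] at h1
      exact Nat.eq_of_mul_eq_mul_right (hS a₀ h0) h1
    · rw [hz H a ha, hz H' a ha]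
  intro a b hab
  have hlen : (proj {a, b} h).length = (proj {a, b} h').length := by
    by_cases e : a = b
    · subst e; rw [length_same, length_same, hcnt]
    · rw [length_pair e, length_pair e, hcnt, hcnt]
  by_cases hl : proj {a, b} l = []
  · have hn : ∀ c ∈ ({a, b} : Set A), c ∉ S := by
      intro c hc hcS
      obtain ⟨x, hx, rfl⟩ := cnt_pos.1 (hS c hcS)
      have : x ∈ proj {a, b} l := mem_proj.2 ⟨hx, hc⟩
      rw [hl] at this; simp at this
    rw [proj_eq_nil fun x hx hx' => hn _ hx' (H.names x hx),
      proj_eq_nil fun x hx hx' => hn _ hx' (H'.names x hx)]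
  · have h1 := H.comm a b hab
    have h2 := H'.comm a b hab
    rw [proj_append, proj_append] at h1 h2
    exact word_unique h1 h2 hlen hl

def PP (Γ : SimpleGraph A) (S : Set A) (l : List (A × Bool)) (a₀ : A) (g : RAAG Γ) (e : ℤ) : Prop :=
  ∃ (h : List (A × Bool)) (N : ℕ), MM Γ S l h ∧ g * E Γ l ^ N = E Γ h ∧
    e = (cnt a₀ h : ℤ) - N * cnt a₀ l

theorem MM.commute {S : Set A} {l h : List (A × Bool)} (H : MM Γ S l h) :
    Commute (E Γ h) (E Γ l) := by
  have := H.comm.E_eq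
  rwa [E_append, E_append] at this

theorem PP.commute {S : Set A} {l : List (A × Bool)} {a₀ : A} {g : RAAG Γ} {e : ℤ}
    (H : PP Γ S l a₀ g e) : Commute g (E Γ l) := by
  obtain ⟨h, N, hM, hg, -⟩ := H
  rw [eq_mul_inv_of_mul_eq hg]
  exact hM.commute.mul_left ((Commute.refl _).pow_left N).inv_left

theorem PP.mul {S : Set A} {l : List (A × Bool)} {a₀ : A} {g g' : RAAG Γ} {e e' : ℤ}
    (H : PP Γ S l a₀ g e) (H' : PP Γ S l a₀ g' e') : PP Γ S l a₀ (g * g') (e + e') := by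
  have hc := H'.commute
  obtain ⟨h, N, hM, hg, rfl⟩ := H
  obtain ⟨h', N', hM', hg', rfl⟩ := H'
  refine ⟨h ++ h', N + N', hM.append hM', ?_, ?_⟩
  · rw [E_append, ← hg, ← hg', pow_add]
    have := (hc.pow_right N).eq
    calc g * g' * (E Γ l ^ N * E Γ l ^ N') = g * (g' * E Γ l ^ N) * E Γ l ^ N' := by group
      _ = _ := by rw [this]; group
  · push_cast [cnt_append]; ring

section
variable {S : Set A} {l : List (A × Bool)} {a₀ : A} (hl : ∀ x ∈ l, x.1 ∈ S)
  (hS : ∀ a ∈ S, 0 < cnt a l) (hconn : ((Γᶜ).induce S).Preconnected) (h0 : a₀ ∈ S)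

include hl hS hconn h0

theorem PP.unique {g g' : RAAG Γ} {e : ℤ}
    (H : PP Γ S l a₀ g e) (H' : PP Γ S l a₀ g' e) : g = g' := by
  obtain ⟨h, N, hM, hg, he⟩ := H
  obtain ⟨h', N', hM', hg', he'⟩ := H'
  have hMl : MM Γ S l l := ⟨hl, Eqv.refl _⟩
  have h1 := (hM.append (hMl.rep N')).unique (hM'.append (hMl.rep N)) hS hconn h0 (by
    simp only [cnt_append, cnt_rep]
    zify; linarith)
  have h2 := h1.E_eq
  rw [E_append, E_append, E_rep, E_rep, ← hg, ← hg', mul_assoc, mul_assoc, ← pow_add, ← pow_add,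
    add_comm N' N] at h2
  exact mul_right_cancel h2

theorem PP.inv {g : RAAG Γ} {e : ℤ} (H : PP Γ S l a₀ g e) : PP Γ S l a₀ g⁻¹ (-e) := by
  obtain ⟨h, N, hM, hg, rfl⟩ := H
  have hMl : MM Γ S l l := ⟨hl, Eqv.refl _⟩
  obtain ⟨K, hK⟩ := Nat.exists_eq_succ_of_ne_zero (hS a₀ h0).ne'
  have h1 := (hM.rep (cnt a₀ l)).unique (hMl.rep (cnt a₀ h)) hS hconn h0 (by
    simp [mul_comm])
  have h2 := h1.E_eq
  rw [E_rep, E_rep, hK, pow_succ'] at h2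
  refine ⟨RG.rep N l ++ RG.rep K h, cnt a₀ h, (hMl.rep N).append (hM.rep K), ?_, ?_⟩
  · rw [E_append, E_rep, E_rep, ← h2, eq_mul_inv_of_mul_eq hg]; group
  · rw [hK]; push_cast [cnt_append, cnt_rep, hK]; ring

theorem PP.zpow {g : RAAG Γ} {e : ℤ} (H : PP Γ S l a₀ g e) (n : ℤ) :
    PP Γ S l a₀ (g ^ n) (n * e) := by
  have hn : ∀ n : ℕ, PP Γ S l a₀ (g ^ n) (n * e) := by
    intro n
    induction n with
    | zero => exact ⟨[], 0, MM.nil S l, by simp, by simp⟩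
    | succ n ih =>
      have := ih.mul H
      rw [pow_succ]
      convert this using 1
      push_cast; ring
  obtain ⟨m, rfl | rfl⟩ := n.eq_nat_or_neg
  · simpa using hn m
  · have := PP.inv hl hS hconn h0 (hn m)
    simpa using this

theorem PP.cyclic : ∃ z : RAAG Γ, ∀ g e, PP Γ S l a₀ g e → ∃ n : ℤ, g = z ^ n := by
  let Z : AddSubgroup ℤ :=
    { carrier := {e | ∃ g, PP Γ S l a₀ g e}
      zero_mem' := ⟨1, [], 0, MM.nil S l, by simp, by simp⟩
      add_mem' := by
        rintro a b ⟨g, hg⟩ ⟨g', hg'⟩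
        exact ⟨_, hg.mul hg'⟩
      neg_mem' := by
        rintro a ⟨g, hg⟩
        exact ⟨_, PP.inv hl hS hconn h0 hg⟩ }
  obtain ⟨d, hd⟩ := Int.subgroup_cyclic Z
  have hdZ : d ∈ Z := by rw [hd]; exact AddSubgroup.subset_closure rfl
  obtain ⟨z, hz⟩ := hdZ
  refine ⟨z, fun g e hg => ?_⟩
  have : e ∈ Z := ⟨g, hg⟩
  rw [hd, AddSubgroup.mem_closure_singleton] at this
  obtain ⟨n, rfl⟩ := this
  exact ⟨n, PP.unique hl hS hconn h0 hg (by simpa using PP.zpow hl hS hconn h0 hz n)⟩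

end

/-! ### retractions -/

noncomputable def ret (Γ : SimpleGraph A) (S : Set A) : RAAG Γ →* RAAG Γ :=
  PresentedGroup.toGroup (f := fun a => if a ∈ S then raagGen Γ a else 1) (by
    rintro r ⟨a, b, hab, rfl⟩
    simp only [map_mul, map_inv, FreeGroup.lift_apply_of]
    rw [mul_inv_eq_one, mul_inv_eq_iff_eq_mul]
    have := (gen_comm hab).eq
    split_ifs <;> simp [this])

theorem ret_gen (S : Set A) (a : A) : ret Γ S (raagGen Γ a) = if a ∈ S then raagGen Γ a else 1 :=
  PresentedGroup.toGroup.of _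

theorem ret_E (S : Set A) (l : List (A × Bool)) : ret Γ S (E Γ l) = E Γ (proj S l) := by
  have h1 : ∀ x : A × Bool, ret Γ S (E Γ [x]) = E Γ (proj S [x]) := by
    rintro ⟨a, s⟩
    by_cases h : a ∈ S
    · rw [proj_cons_mem h]
      cases s <;> simp [E_true, E_false, ret_gen, h]
    · rw [proj_cons_not h]
      cases s <;> simp [E_true, E_false, ret_gen, h]
  induction l with
  | nil => simp
  | cons x l ih =>
    rw [E_cons, map_mul, ih, h1, ← E_append, ← proj_append]; rfl

def PS (Γ : SimpleGraph A) (S : Set A) : Subgroup (RAAG Γ) := Subgroup.closure (raagGen Γ '' S)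

theorem ret_self {S : Set A} {g : RAAG Γ} (hg : g ∈ PS Γ S) : ret Γ S g = g := by
  have : PS Γ S ≤ (ret Γ S).eqLocus (MonoidHom.id _) := by
    unfold PS
    rw [Subgroup.closure_le]
    rintro _ ⟨a, ha, rfl⟩
    show ret Γ S (raagGen Γ a) = raagGen Γ a
    rw [ret_gen, if_pos ha]
  exact this hg

theorem ret_disj {S T : Set A} (hd : Disjoint S T) {g : RAAG Γ} (hg : g ∈ PS Γ T) :
    ret Γ S g = 1 := by
  have : PS Γ T ≤ (ret Γ S).ker := by
    unfold PS
    rw [Subgroup.closure_le]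
    rintro _ ⟨a, ha, rfl⟩
    show ret Γ S (raagGen Γ a) = 1
    rw [ret_gen, if_neg (fun h => Set.disjoint_left.1 hd h ha)]
  exact this hg

theorem E_mem {S : Set A} {l : List (A × Bool)} (h : ∀ x ∈ l, x.1 ∈ S) : E Γ l ∈ PS Γ S := by
  induction l with
  | nil => simp
  | cons x l ih =>
    rw [E_cons]
    refine mul_mem ?_ (ih fun y hy => h y (by simp [hy]))
    obtain ⟨a, s⟩ := x
    have : raagGen Γ a ∈ PS Γ S := Subgroup.subset_closure ⟨a, h (a, s) (by simp), rfl⟩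
    cases s
    · rw [E_false]; exact inv_mem this
    · rw [E_true]; exact this

theorem PS_comm {S T : Set A} (h : ∀ a ∈ S, ∀ b ∈ T, Γ.Adj a b) {g g' : RAAG Γ}
    (hg : g ∈ PS Γ S) (hg' : g' ∈ PS Γ T) : Commute g g' := by
  have h1 : ∀ a ∈ S, PS Γ T ≤ Subgroup.centralizer {raagGen Γ a} := by
    intro a ha
    unfold PS
    rw [Subgroup.closure_le]
    rintro _ ⟨b, hb, rfl⟩
    exact Subgroup.mem_centralizer_singleton_iff.2 (gen_comm (h a ha b hb)).symm
  have h2 : PS Γ S ≤ Subgroup.centralizer {g'} := by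
    unfold PS
    rw [Subgroup.closure_le]
    rintro _ ⟨a, ha, rfl⟩
    have := Subgroup.mem_centralizer_singleton_iff.1 (h1 a ha hg')
    exact Subgroup.mem_centralizer_singleton_iff.2 this.symm
  exact Subgroup.mem_centralizer_singleton_iff.1 (h2 hg)

/-! ### block lemma -/

theorem block_lemma {S : Set A} {l : List (A × Bool)} (hlS : ∀ x ∈ l, x.1 ∈ S)
    (hS : ∀ a ∈ S, ∃ x ∈ l, x.1 = a) (hconn : ((Γᶜ).induce S).Connected)
    (hred : Red Γ (l ++ l)) {r : RAAG Γ} {m : ℤ} (hm : m ≠ 0) (hr : E Γ l = r ^ m)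
    (hroot : ¬∃ (u : RAAG Γ) (m' : ℤ), 2 ≤ |m'| ∧ r = u ^ m') :
    r ∈ PS Γ S ∧ ∀ h, MM Γ S l h → E Γ h ∈ Subgroup.zpowers r := by
  have hS' : ∀ a ∈ S, 0 < cnt a l := fun a ha => cnt_pos.2 (hS a ha)
  obtain ⟨⟨a₀, h0⟩⟩ := hconn.nonempty
  have hcr : Commute r (E Γ l) := by rw [hr]; exact (Commute.refl r).zpow_right m
  obtain ⟨N, h, hh, hc⟩ := growth hred hcr
  have hout : ∀ x ∈ h, x.1 ∉ S → ∀ a ∈ S, Γ.Adj a x.1 := by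
    intro x hx hxS a ha
    obtain ⟨y, hy, rfl⟩ := hS a ha
    exact letters_adj hc hx (fun z hz e => hxS (e ▸ hlS z hz)) hy
  have hsp := split_aux (Γ := Γ) S (h := h) (fun x _ y hy hxS hyS => hout y hy hyS x.1 hxS)
  have hM : MM Γ S l (proj S h) := by
    refine ⟨fun x hx => (mem_proj.1 hx).2, ?_⟩
    have := hc.proj S
    rwa [proj_append, proj_append, proj_eq_self hlS] at this
  have hvS : E Γ l ∈ PS Γ S := E_mem hlS
  set s := E Γ (proj S h) * (E Γ l ^ N)⁻¹ with hs
  set c := E Γ (proj Sᶜ h) with hcdef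
  have hsS : s ∈ PS Γ S :=
    mul_mem (E_mem fun x hx => (mem_proj.1 hx).2) (inv_mem (pow_mem hvS N))
  let T : Set A := {b | b ∉ S ∧ ∀ a ∈ S, Γ.Adj a b}
  have hcT : c ∈ PS Γ T := E_mem fun x hx => by
    obtain ⟨h1, h2⟩ := mem_proj.1 hx
    exact ⟨h2, hout x h1 h2⟩
  have hST : ∀ a ∈ S, ∀ b ∈ T, Γ.Adj a b := fun a ha b hb => hb.2 a ha
  have hdST : Disjoint T S := Set.disjoint_left.2 fun a ha => ha.1
  have hrsc : r = s * c := by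
    have h1 : r * E Γ l ^ N = E Γ (proj S h) * c := by rw [← hh, hsp.E_eq, E_append]
    have h2 := (PS_comm hST (inv_mem (pow_mem hvS N)) hcT).eq
    rw [eq_mul_inv_of_mul_eq h1, hs, mul_assoc, mul_assoc, h2]
  have hc1 : c = 1 := by
    apply torsion_free hm
    have h1 := congrArg (ret Γ T) hr
    rw [hrsc, (PS_comm hST hsS hcT).mul_zpow, map_mul, ret_disj hdST hvS,
      ret_disj hdST (zpow_mem hsS m), one_mul, ret_self (zpow_mem hcT m)] at h1
    exact h1.symm
  have hrs : r = s := by rw [hrsc, hc1, mul_one]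
  refine ⟨hrs ▸ hsS, ?_⟩
  obtain ⟨z, hz⟩ := PP.cyclic (Γ := Γ) hlS hS' hconn.preconnected h0
  obtain ⟨n, hn⟩ := hz r _ ⟨proj S h, N, hM, by rw [hrs, hs]; group, rfl⟩
  have hn1 : n = 1 ∨ n = -1 := by
    have h1 : ¬ 2 ≤ |n| := fun h => hroot ⟨z, n, h, hn⟩
    have h2 : n ≠ 0 := by
      rintro rfl
      exact hroot ⟨1, 2, by norm_num, by simpa using hn⟩
    rcases abs_cases n with h | h <;> omega
  intro h' hM'
  obtain ⟨j, hj⟩ := hz (E Γ h') _ ⟨h', 0, hM', by simp, rfl⟩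
  rw [hj]
  apply zpow_mem
  rcases hn1 with rfl | rfl
  · rw [hn]; simp
  · rw [hn]; simp

/-! ### products -/

theorem ofFn_mul {G : Type*} [Group G] {k : ℕ} (a b : Fin k → G)
    (h : ∀ i j, i ≠ j → Commute (a i) (b j)) :
    (List.ofFn fun i => a i * b i).prod = (List.ofFn a).prod * (List.ofFn b).prod := by
  induction k with
  | zero => simp
  | succ k ih =>
    rw [List.ofFn_succ, List.ofFn_succ, List.ofFn_succ, List.prod_cons, List.prod_cons,
      List.prod_cons, ih _ _ fun i j hij => h _ _ (by simpa using hij)]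
    have : Commute (b 0) (List.ofFn fun i : Fin k => a i.succ).prod := by
      apply Commute.list_prod_right
      intro x hx
      obtain ⟨i, rfl⟩ := (List.mem_ofFn' _ _).1 hx
      exact (h _ _ (Fin.succ_ne_zero i)).symm
    have e := this.eq
    simp only [mul_assoc]
    rw [← mul_assoc (b 0), e]
    simp only [mul_assoc]

theorem ofFn_single {G : Type*} [Group G] {k : ℕ} (a : Fin k → G) (j : Fin k)
    (h : ∀ i, i ≠ j → a i = 1) : (List.ofFn a).prod = a j := by
  induction k with
  | zero => exact j.elim0
  | succ k ih =>
    rw [List.ofFn_succ, List.prod_cons]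
    refine Fin.cases ?_ ?_ j (motive := fun j => (∀ i, i ≠ j → a i = 1) →
      a 0 * (List.ofFn fun i : Fin k => a i.succ).prod = a j) h
    · intro h
      have : (List.ofFn fun i : Fin k => a i.succ).prod = 1 := by
        apply List.prod_eq_one
        intro x hx
        obtain ⟨i, rfl⟩ := (List.mem_ofFn' _ _).1 hx
        exact h _ (Fin.succ_ne_zero i)
      rw [this, mul_one]
    · intro j h
      rw [h 0 (Fin.succ_ne_zero j).symm, one_mul]
      exact ih (fun i => a i.succ) j fun i hi => h _ (by simpa using hi)

theorem mu_mul {k : ℕ} {S : Fin k → Set A} {T : Set A}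
    (hS : ∀ i j, i ≠ j → ∀ a ∈ S i, ∀ b ∈ S j, Γ.Adj a b)
    (hT : ∀ i, ∀ a ∈ S i, ∀ b ∈ T, Γ.Adj a b)
    {a b : Fin k → RAAG Γ} {c d : RAAG Γ} (ha : ∀ i, a i ∈ PS Γ (S i)) (hb : ∀ i, b i ∈ PS Γ (S i))
    (hc : c ∈ PS Γ T) :
    (List.ofFn fun i => a i * b i).prod * (c * d) =
      ((List.ofFn a).prod * c) * ((List.ofFn b).prod * d) := by
  rw [ofFn_mul _ _ fun i j hij => PS_comm (hS i j hij) (ha i) (hb j)]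
  have : Commute c (List.ofFn b).prod := by
    apply Commute.list_prod_right
    intro x hx
    obtain ⟨i, rfl⟩ := (List.mem_ofFn' _ _).1 hx
    exact (PS_comm (hT i) (hb i) hc).symm
  have e := this.eq
  simp only [mul_assoc]
  rw [← mul_assoc c, e]
  simp only [mul_assoc]

theorem decomp {k : ℕ} {S : Fin k → Set A} {T : Set A}
    (hS : ∀ i j, i ≠ j → ∀ a ∈ S i, ∀ b ∈ S j, Γ.Adj a b)
    (hT : ∀ i, ∀ a ∈ S i, ∀ b ∈ T, Γ.Adj a b) (h : List (A × Bool))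
    (hh : ∀ x ∈ h, (∃ i, x.1 ∈ S i) ∨ x.1 ∈ T) :
    E Γ h = (List.ofFn fun i => E Γ (proj (S i) h)).prod * E Γ (proj T h) := by
  have hm : ∀ (U : Set A) l, E Γ (proj U l) ∈ PS Γ U := fun U l =>
    E_mem fun x hx => (mem_proj.1 hx).2
  induction h with
  | nil => simp
  | cons x h ih =>
    have e : ∀ U : Set A, E Γ (proj U (x :: h)) = E Γ (proj U [x]) * E Γ (proj U h) := by
      intro U; rw [← E_append, ← proj_append]; rfl
    simp only [e]
    rw [mu_mul hS hT (fun i => hm _ _) (fun i => hm _ _) (hm _ _),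
      ← ih fun y hy => hh y (by simp [hy]), E_cons]
    congr 1
    rcases hh x (by simp) with ⟨j, hj⟩ | hx
    · rw [ofFn_single _ j, proj_cons_mem hj, proj_cons_not]
      · simp
      · intro hxT; exact Γ.irrefl (hT j _ hj _ hxT)
      · intro i hij
        rw [proj_cons_not]
        · simp
        · intro hi; exact Γ.irrefl (hS i j hij _ hi _ hj)
    · rw [proj_cons_mem hx, List.prod_eq_one]
      · simp
      · intro y hy
        obtain ⟨i, rfl⟩ := (List.mem_ofFn' _ _).1 hy
        beta_reduce
        rw [proj_cons_not]
        · simp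
        · intro hi; exact Γ.irrefl (hT i _ hi _ hx)

theorem disj_adj {l m : List (A × Bool)} (hl : Red Γ l) (hm : Red Γ m)
    (hd : ∀ x ∈ l, ∀ y ∈ m, x.1 ≠ y.1) (hc : Commute (E Γ l) (E Γ m)) {x y : A × Bool}
    (hx : x ∈ l) (hy : y ∈ m) : Γ.Adj x.1 y.1 := by
  have h1 : Red Γ (l ++ m) := by
    by_contra h
    obtain ⟨l1, x, l2, p, q, rfl, rfl, -, -⟩ := straddle hl hm h
    exact hd x (by simp) (iv x) (by simp) rfl
  have h2 : Red Γ (m ++ l) := by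
    by_contra h
    obtain ⟨l1, x, l2, p, q, rfl, rfl, -, -⟩ := straddle hm hl h
    exact hd (iv x) (by simp) x (by simp) rfl
  have h3 := red_unique h1 h2 (by rw [E_append, E_append, hc.eq])
  exact (letters_adj h3 hx (fun z hz e => hd x hx z hz e.symm) hy).symm

theorem red_single (x : A × Bool) : Red Γ [x] := by
  apply red_cons red_nil
  rintro ⟨m, hm⟩
  simpa using hm.perm.length_eq

end RG

open RG in
/-- Centraliser Theorem for RAAGs: if `w` is cyclically reduced with block
decomposition `w = v₁ ⋯ v_k`, then `C(w) = ⟨√v₁⟩ × ⋯ × ⟨√v_k⟩ × 𝔸(w)`, where `√vᵢ`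
is the least root of `vᵢ` and `𝔸(w)` is the subgroup generated by the generators that
do not occur in `α(w)` and commute with `w`.  The internal direct product structure is
expressed by a group isomorphism from the external product onto the centraliser given
by multiplication. -/
theorem raag_centralizer_theorem {A : Type} [Fintype A] (Γ : SimpleGraph A)
    (w : RAAG Γ) (hcyc : CyclicallyReduced Γ w)
    (k : ℕ) (v : Fin k → RAAG Γ)
    -- block decomposition `w = v₁ ⋯ v_k`:
    (hprod : w = (List.ofFn v).prod)
    (hne : ∀ i, v i ≠ 1)
    (hblock : ∀ i, IsBlock Γ (v i))
    (hcomm : ∀ i j, i ≠ j → Commute (v i) (v j))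
    (hdisj : ∀ i j, i ≠ j → Disjoint (raagSupp Γ (v i)) (raagSupp Γ (v j)))
    (hsupp : raagSupp Γ w = ⋃ i, raagSupp Γ (v i))
    -- `r i` is the least root `√(v i)`:
    (r : Fin k → RAAG Γ)
    (hroot : ∀ i, (∃ m : ℤ, m ≠ 0 ∧ v i = r i ^ m) ∧
      ¬∃ (u : RAAG Γ) (m' : ℤ), 2 ≤ |m'| ∧ r i = u ^ m') :
    ∃ φ : ((∀ i : Fin k, Subgroup.zpowers (r i)) ×
        Subgroup.closure {x : RAAG Γ | ∃ a : A,
          a ∉ raagSupp Γ w ∧ Commute (raagGen Γ a) w ∧ x = raagGen Γ a}) ≃*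
        Subgroup.centralizer ({w} : Set (RAAG Γ)),
      ∀ p, (φ p : RAAG Γ) =
        (List.ofFn fun i => ((p.1 i : RAAG Γ))).prod * (p.2 : RAAG Γ) := by
  classical
  -- words for the blocks
  have hadj : ∀ i j, i ≠ j → ∀ a ∈ raagSupp Γ (v i), ∀ b ∈ raagSupp Γ (v j), Γ.Adj a b := by
    intro i j hij a ha b hb
    obtain ⟨l, hl, hlr⟩ := exists_red (v i)
    obtain ⟨m, hm, hmr⟩ := exists_red (v j)
    have hd := hdisj i j hij
    have hc := hcomm i j hij
    rw [← hl, supp_eq hlr] at ha hd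
    rw [← hm, supp_eq hmr] at hb hd
    rw [← hl, ← hm] at hc
    obtain ⟨x, hx, rfl⟩ := ha
    obtain ⟨y, hy, rfl⟩ := hb
    exact disj_adj hlr hmr (fun x hx y hy e => Set.disjoint_left.1 hd ⟨x, hx, rfl⟩ ⟨y, hy, e.symm⟩)
      hc hx hy
  have hvP : ∀ i, v i ∈ PS Γ (raagSupp Γ (v i)) := by
    intro i
    obtain ⟨l, hl, hlr⟩ := exists_red (v i)
    have : E Γ l ∈ PS Γ (raagSupp Γ (E Γ l)) := E_mem fun x hx => by
      rw [supp_eq hlr]; exact ⟨x, hx, rfl⟩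
    rwa [hl] at this
  obtain ⟨lw, hlw, hlwr⟩ := exists_red w
  have hsw : raagSupp Γ w = {a | ∃ x ∈ lw, x.1 = a} := by rw [← hlw, supp_eq hlwr]
  have hlw2 : Red Γ (lw ++ lw) := by
    apply geod_red
    have h1 := red_geod hlwr
    rw [E_append, hlw, List.length_append, hcyc, ← hlw, h1]; ring
  let T : Set A := {a | a ∉ raagSupp Γ w ∧ Commute (raagGen Γ a) w}
  have hTset : {x : RAAG Γ | ∃ a : A, a ∉ raagSupp Γ w ∧ Commute (raagGen Γ a) w ∧
      x = raagGen Γ a} = raagGen Γ '' T := by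
    ext x
    constructor
    · rintro ⟨a, h1, h2, rfl⟩; exact ⟨a, ⟨h1, h2⟩, rfl⟩
    · rintro ⟨a, ⟨h1, h2⟩, rfl⟩; exact ⟨a, h1, h2, rfl⟩
  have hSw : ∀ i, ∀ a ∈ raagSupp Γ (v i), ∃ x ∈ lw, x.1 = a := by
    intro i a ha
    have : a ∈ raagSupp Γ w := by rw [hsupp]; exact Set.mem_iUnion.2 ⟨i, ha⟩
    rwa [hsw] at this
  have hTadj : ∀ i, ∀ a ∈ raagSupp Γ (v i), ∀ b ∈ T, Γ.Adj a b := by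
    intro i a ha b hb
    obtain ⟨x, hx, rfl⟩ := hSw i a ha
    refine (disj_adj (x := (b, true)) (red_single _) hlwr ?_ ?_ (List.mem_singleton_self _) hx).symm
    · intro u hu y hy e
      rw [List.mem_singleton.1 hu] at e
      apply hb.1
      rw [hsw]; exact ⟨y, hy, e.symm⟩
    · rw [hlw]; exact hb.2
  have hTdisj : ∀ i, Disjoint (raagSupp Γ (v i)) T := by
    intro i
    refine Set.disjoint_left.2 fun a ha hb => hb.1 ?_
    rw [hsupp]; exact Set.mem_iUnion.2 ⟨i, ha⟩
  have hret : ∀ i (a : Fin k → RAAG Γ), (∀ j, a j ∈ PS Γ (raagSupp Γ (v j))) →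
      ret Γ (raagSupp Γ (v i)) (List.ofFn a).prod = a i := by
    intro i a ha
    rw [map_list_prod, List.map_ofFn, ofFn_single _ i]
    · exact ret_self (ha i)
    · intro j hj
      exact ret_disj (hdisj i j hj.symm) (ha j)
  have hf : ∀ i, E Γ (proj (raagSupp Γ (v i)) lw) = v i := by
    intro i
    rw [← ret_E, hlw]
    conv_lhs => rw [hprod]
    exact hret i v hvP
  have hblk : ∀ i, r i ∈ PS Γ (raagSupp Γ (v i)) ∧
      ∀ h, MM Γ (raagSupp Γ (v i)) (proj (raagSupp Γ (v i)) lw) h →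
        E Γ h ∈ Subgroup.zpowers (r i) := by
    intro i
    obtain ⟨⟨m, hm, hv⟩, hr⟩ := hroot i
    refine block_lemma (m := m) (fun x hx => (mem_proj.1 hx).2) ?_ (hblock i) ?_ hm
      ((hf i).trans hv) hr
    · intro a ha
      obtain ⟨x, hx, rfl⟩ := hSw i a ha
      exact ⟨x, mem_proj.2 ⟨hx, ha⟩, rfl⟩
    · rw [← proj_append]
      have hsp := split_aux (Γ := Γ) (raagSupp Γ (v i)) (h := lw ++ lw) (by
        intro x _ y hy hxS hyS
        have hy' : y ∈ lw := by simpa using hy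
        have : y.1 ∈ raagSupp Γ w := by rw [hsw]; exact ⟨y, hy', rfl⟩
        rw [hsupp] at this
        obtain ⟨j, hj⟩ := Set.mem_iUnion.1 this
        refine hadj i j ?_ _ hxS _ hj
        rintro rfl
        exact hyS hj)
      exact (hlw2.eqv hsp).left
  have hzP : ∀ i, Subgroup.zpowers (r i) ≤ PS Γ (raagSupp Γ (v i)) := fun i =>
    Subgroup.zpowers_le.2 (hblk i).1
  have hvz : ∀ i, v i ∈ Subgroup.zpowers (r i) := by
    intro i
    obtain ⟨⟨m, -, hv⟩, -⟩ := hroot i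
    rw [hv]; exact Subgroup.zpow_mem_zpowers _ _
  rw [hTset]
  let F : ((∀ i : Fin k, Subgroup.zpowers (r i)) × Subgroup.closure (raagGen Γ '' T)) →* RAAG Γ :=
    MonoidHom.mk' (fun p => (List.ofFn fun i => ((p.1 i : RAAG Γ))).prod * (p.2 : RAAG Γ)) (by
      intro p q
      exact mu_mul hadj hTadj (fun i => hzP i (p.1 i).2) (fun i => hzP i (q.1 i).2) p.2.2)
  have hFapp : ∀ p, F p = (List.ofFn fun i => ((p.1 i : RAAG Γ))).prod * (p.2 : RAAG Γ) :=
    fun _ => rfl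
  have hFret : ∀ p i, ret Γ (raagSupp Γ (v i)) (F p) = p.1 i := by
    intro p i
    rw [hFapp, map_mul, hret i _ fun j => hzP j (p.1 j).2, ret_disj (hTdisj i) p.2.2, mul_one]
  have hinj : Function.Injective F := by
    intro p q hpq
    have h1 : p.1 = q.1 := by
      funext i
      apply Subtype.ext
      rw [← hFret, ← hFret, hpq]
    have h2 : p.2 = q.2 := by
      apply Subtype.ext
      rw [hFapp, hFapp, h1] at hpq
      exact mul_left_cancel hpq
    exact Prod.ext h1 h2
  have hw : w ∈ F.range := by
    refine ⟨(fun i => ⟨v i, hvz i⟩, 1), ?_⟩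
    rw [hFapp, hprod]; simp
  have hrange : F.range = Subgroup.centralizer ({w} : Set (RAAG Γ)) := by
    apply le_antisymm
    · rintro _ ⟨p, rfl⟩
      rw [Subgroup.mem_centralizer_singleton_iff]
      obtain ⟨q, hq⟩ := hw
      rw [← hq]
      have hpc : Commute (F p) (F q) := by
        have hq1 : ∀ i, (q.1 i : RAAG Γ) = v i := by
          intro i
          rw [← hFret, hq]
          conv_lhs => rw [hprod]
          exact hret i v hvP
        have hq2 : q.2 = 1 := by
          apply Subtype.ext
          rw [hFapp] at hq
          simp only [hq1] at hq
          rw [← hprod] at hq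
          simpa using hq
        show F p * F q = F q * F p
        rw [← map_mul, ← map_mul]
        congr 1
        refine Prod.ext ?_ ?_
        · funext i
          apply Subtype.ext
          obtain ⟨a, ha⟩ := Subgroup.mem_zpowers_iff.1 (p.1 i).2
          obtain ⟨b, hb⟩ := Subgroup.mem_zpowers_iff.1 (q.1 i).2
          show (p.1 i : RAAG Γ) * (q.1 i : RAAG Γ) = (q.1 i : RAAG Γ) * (p.1 i : RAAG Γ)
          rw [← ha, ← hb]
          exact ((Commute.refl (r i)).zpow_zpow a b).eq
        · show p.2 * q.2 = q.2 * p.2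
          rw [hq2]; simp
      exact hpc
    · intro g hg
      rw [Subgroup.mem_centralizer_singleton_iff] at hg
      obtain ⟨N, h, hh, hc⟩ := growth hlw2 (g := g) (by rw [hlw]; exact hg)
      rw [hlw] at hh
      have hnames : ∀ x ∈ h, (∃ i, x.1 ∈ raagSupp Γ (v i)) ∨ x.1 ∈ T := by
        intro x hx
        by_cases hxw : x.1 ∈ raagSupp Γ w
        · left; rw [hsupp] at hxw; exact Set.mem_iUnion.1 hxw
        · right
          refine ⟨hxw, ?_⟩
          rw [hsw] at hxw
          have hcom : Com Γ lw (x.1, true) := by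
            intro y hy
            have := letters_adj (x := x) (y := y) hc hx (fun z hz e => hxw ⟨z, hz, e⟩) hy
            exact this
          have := (com_comm hcom).symm
          rwa [hlw] at this
      have hd := decomp hadj hTadj h hnames
      have hhr : E Γ h ∈ F.range := by
        have hz : ∀ i, E Γ (proj (raagSupp Γ (v i)) h) ∈ Subgroup.zpowers (r i) := by
          intro i
          refine (hblk i).2 _ ⟨fun x hx => (mem_proj.1 hx).2, ?_⟩
          rw [← proj_append, ← proj_append]
          exact hc.proj _
        refine ⟨(fun i => ⟨_, hz i⟩, ⟨E Γ (proj T h), E_mem fun x hx => (mem_proj.1 hx).2⟩), ?_⟩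
        rw [hFapp, hd]
      rw [eq_mul_inv_of_mul_eq hh.symm]
      exact mul_mem hhr (inv_mem (pow_mem hw N))
  exact ⟨(MonoidHom.ofInjective hinj).trans (MulEquiv.subgroupCongr hrange), fun p => rfl⟩
end

section
/- (Big powers property) Let 𝔾 be a right-angled Artin group and let w ∈ 𝔾[x] = 𝔾 * ⟨x⟩ be a nontrivial element of the form w = x^{k_1} g_1 x^{k_2} g_2 ⋯ x^{k_l} g_l with k_1,...,k_l nonzero integers and g_1,...,g_l ∈ 𝔾 nontrivial. Suppose there exists a cyclically reduced block element b ∈ 𝔾 such that [b, g_i] ≠ 1 for all i = 1,...,l−1. Then there exists a positive integer N such that for all n > N, the 𝔾-homomorphism φ_{b,n} : 𝔾[x] → 𝔾 induced by x ↦ b^n maps w to a nontrivial element of 𝔾. -/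
/-- `𝔾[x] = 𝔾 * ⟨x⟩`: the free product of `𝔾(Γ)` with the infinite cyclic group on `x`. -/
abbrev RAAGX {A : Type} (Γ : SimpleGraph A) :=
  Monoid.Coprod (RAAG Γ) (FreeGroup Unit)

/-- The variable `x` of `𝔾[x]`. -/
def Xvar {A : Type} (Γ : SimpleGraph A) : RAAGX Γ :=
  Monoid.Coprod.inr (FreeGroup.of ())

/-- The `𝔾`-homomorphism `φ_{b,n} : 𝔾[x] → 𝔾` induced by `x ↦ bⁿ`. -/
def phiPow {A : Type} (Γ : SimpleGraph A) (b : RAAG Γ) (n : ℕ) : RAAGX Γ →* RAAG Γ :=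
  Monoid.Coprod.lift (MonoidHom.id (RAAG Γ)) (FreeGroup.lift fun _ => b ^ n)

section FreePart
variable {X : Type*} [DecidableEq X]

/-- length of the longest common prefix -/
def lcpLen : List (X × Bool) → List (X × Bool) → ℕ
  | [], _ => 0
  | _ :: _, [] => 0
  | x :: xs, y :: ys => if x = y then lcpLen xs ys + 1 else 0

theorem lcpLen_min : ∀ (u v w : List (X × Bool)),
    min (lcpLen u v) (lcpLen v w) ≤ lcpLen u w
  | [], v, w => by simp [lcpLen]
  | x :: u, [], w => by simp [lcpLen]
  | x :: u, y :: v, [] => by simp [lcpLen]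
  | x :: u, y :: v, z :: w => by
    have := lcpLen_min u v w
    simp only [lcpLen]
    split_ifs <;> simp_all

theorem norm_inv_mul_mk : ∀ (u v : List (X × Bool)), FreeGroup.IsReduced u →
    FreeGroup.IsReduced v →
    ((FreeGroup.mk u)⁻¹ * FreeGroup.mk v).norm + 2 * lcpLen u v = u.length + v.length
  | [], v, _, hv => by
    simp only [lcpLen, FreeGroup.inv_mk, FreeGroup.mul_mk, FreeGroup.invRev, FreeGroup.norm, FreeGroup.toWord_mk]
    simp [hv.reduce_eq]
  | x :: u, [], hu, _ => by
    rw [show FreeGroup.mk ([] : List (X × Bool)) = 1 from rfl, mul_one, FreeGroup.norm_inv_eq]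
    simp only [lcpLen, FreeGroup.norm, FreeGroup.toWord_mk, hu.reduce_eq]
    simp
  | x :: u, y :: v, hu, hv => by
    by_cases h : x = y
    · subst h
      have := norm_inv_mul_mk u v (hu.infix ⟨[x], [], by simp⟩) (hv.infix ⟨[x], [], by simp⟩)
      have e : (FreeGroup.mk (x :: u))⁻¹ * FreeGroup.mk (x :: v) = (FreeGroup.mk u)⁻¹ * FreeGroup.mk v := by
        rw [show x :: u = [x] ++ u from rfl, show x :: v = [x] ++ v from rfl,
          ← FreeGroup.mul_mk, ← FreeGroup.mul_mk]
        group
      rw [e]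
      simp only [lcpLen, if_true, List.length_cons]
      omega
    · have hr : FreeGroup.IsReduced (FreeGroup.invRev (x :: u) ++ (y :: v)) := by
        have h1 : FreeGroup.IsReduced (FreeGroup.invRev (x :: u)) := by
          rw [FreeGroup.isReduced_iff_reduce_eq, FreeGroup.reduce_invRev, hu.reduce_eq]
        have h2 : FreeGroup.invRev (x :: u) = FreeGroup.invRev u ++ [(x.1, !x.2)] := by
          simp [FreeGroup.invRev]
        rw [h2] at h1 ⊢
        refine FreeGroup.IsReduced.append_overlap h1 ?_ (by simp)
        simp only [List.singleton_append, FreeGroup.isReduced_cons_cons]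
        refine ⟨fun h3 => ?_, hv⟩
        by_contra h4
        apply h
        ext
        · exact h3
        · revert h4; cases x.2 <;> cases y.2 <;> simp
      rw [FreeGroup.inv_mk, FreeGroup.mul_mk, FreeGroup.norm, FreeGroup.toWord_mk, hr.reduce_eq]
      simp [lcpLen, h, FreeGroup.invRev]
      omega

theorem norm_fp (x y z : FreeGroup X) :
    ((x⁻¹ * z).norm : ℤ) + y.norm ≤
      max ((x⁻¹ * y).norm + (z.norm : ℤ)) ((y⁻¹ * z).norm + (x.norm : ℤ)) := by
  have h (u v : FreeGroup X) : (u⁻¹ * v).norm + 2 * lcpLen u.toWord v.toWord = u.norm + v.norm := by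
    have := norm_inv_mul_mk u.toWord v.toWord FreeGroup.isReduced_toWord FreeGroup.isReduced_toWord
    rwa [FreeGroup.mk_toWord, FreeGroup.mk_toWord] at this
  have h1 := h x z
  have h2 := h x y
  have h3 := h y z
  have h4 := lcpLen_min x.toWord y.toWord z.toWord
  omega

end FreePart

/-- Lyndon length functions -/
structure TreeLen {G : Type*} [Group G] (f : G → ℤ) : Prop where
  one : f 1 = 0
  nonneg : ∀ g, 0 ≤ f g
  inv : ∀ g, f g⁻¹ = f g
  mul_le : ∀ g h, f (g * h) ≤ f g + f h
  fp : ∀ x y z, f (x⁻¹ * z) + f y ≤ max (f (x⁻¹ * y) + f z) (f (y⁻¹ * z) + f x)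

namespace TreeLen
variable {G : Type*} [Group G] {f : G → ℤ} (hf : TreeLen f)
include hf

theorem symm (x y : G) : f (x⁻¹ * y) = f (y⁻¹ * x) := by
  rw [← hf.inv]; simp

theorem fp4 (x y z w : G) : f (x⁻¹ * z) + f (y⁻¹ * w) ≤
    max (f (x⁻¹ * y) + f (z⁻¹ * w)) (f (y⁻¹ * z) + f (x⁻¹ * w)) := by
  have := hf.fp (w⁻¹ * x) (w⁻¹ * y) (w⁻¹ * z)
  simp only [mul_inv_rev, inv_inv, mul_assoc, mul_inv_cancel_left] at this
  rwa [hf.symm w x, hf.symm w y, hf.symm w z] at this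

theorem pow_le (g : G) (n : ℕ) : f (g ^ n) ≤ n * f g := by
  induction n with
  | zero => simp [hf.one]
  | succ n ih =>
    rw [pow_succ]
    have := hf.mul_le (g ^ n) g
    push_cast
    linarith

theorem le_left (x y : G) : f x ≤ f (x * y) + f y := by
  have := hf.mul_le (x * y) y⁻¹
  rw [hf.inv] at this
  simpa using this

theorem le_right (x y : G) : f y ≤ f (x * y) + f x := by
  have := hf.mul_le x⁻¹ (x * y)
  rw [hf.inv] at this
  simp at this
  linarith

theorem pow_eq (b : G) (h2 : f (b * b) = 2 * f b) (n : ℕ) : f (b ^ n) = n * f b := by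
  rcases (hf.nonneg b).eq_or_lt with h0 | h0
  · have := hf.pow_le b n
    have h3 := hf.nonneg (b ^ n)
    rw [← h0] at this ⊢
    linarith
  · suffices H : f (b ^ n) = n * f b ∧ f (b ^ (n + 1)) = (n + 1) * f b from H.1
    induction n with
    | zero => simp [hf.one]
    | succ n ih =>
      refine ⟨by push_cast; exact ih.2, ?_⟩
      have h := hf.fp b⁻¹ (b ^ (n + 1)) b
      have e1 : (b ^ (n + 1))⁻¹ * b = (b ^ n)⁻¹ := by rw [pow_succ']; group
      have e2 : b⁻¹⁻¹ * b ^ (n + 1) = b ^ (n + 1 + 1) := by rw [pow_succ' b (n + 1)]; group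
      rw [e1, e2, inv_inv, hf.inv, hf.inv, ih.1, ih.2, h2] at h
      have h3 := hf.mul_le (b ^ (n + 1)) b
      rw [← pow_succ, ih.2] at h3
      push_cast
      rcases le_max_iff.1 h with h | h <;> linarith

theorem root {b c : G} (hr : 0 < f b) (hb : ∀ n : ℕ, f (b ^ n) = n * f b) {m : ℕ} (hm : 0 < m)
    (hc : c ^ m = b ^ m) : f (b⁻¹ * c) = 0 := by
  obtain ⟨j, hj⟩ : ∃ j : ℕ, f c < j := ⟨(f c).toNat + 1, by push_cast; have := Int.self_le_toNat (f c); linarith⟩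
  obtain ⟨N, hN⟩ : ∃ N, m * (j + 2) = N + 1 := ⟨m * (j + 2) - 1, by
    have : 0 < m * (j + 2) := by positivity
    omega⟩
  have hcN : c ^ (N + 1) = b ^ (N + 1) := by rw [← hN, pow_mul, pow_mul, hc]
  have hNj : (j : ℤ) ≤ N + 1 := by
    have : j + 2 ≤ N + 1 := by rw [← hN]; exact Nat.le_mul_of_pos_left _ hm
    exact_mod_cast (by omega : j ≤ N + 1)
  have low (k : ℕ) : k * f b ≤ f (c ^ k) := by
    have h1 : f ((c ^ k) ^ m) = (m * k : ℕ) * f b := by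
      rw [← pow_mul, mul_comm, pow_mul, hc, ← pow_mul, hb]
    have h2 := hf.pow_le (c ^ k) m
    rw [h1] at h2
    push_cast at h2
    rw [mul_assoc] at h2
    exact le_of_mul_le_mul_left h2 (by exact_mod_cast hm)
  have l1 := low N
  have l2 := low (N + 2)
  have h4 := hf.fp4 1 (c ^ (N + 1)) (c ^ (N + 2)) c
  have e1 : (c ^ (N + 1))⁻¹ * c = (c ^ N)⁻¹ := by rw [pow_succ']; group
  have e2 : (c ^ (N + 2))⁻¹ * c = (c ^ (N + 1))⁻¹ := by rw [pow_succ']; group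
  have e3 : (c ^ (N + 1))⁻¹ * c ^ (N + 2) = c := by rw [pow_succ c (N + 1)]; group
  rw [e1, e2, e3, hf.inv, hf.inv, inv_one, one_mul, one_mul, one_mul, hcN, hb] at h4
  have h5 := hf.fp4 b (b ^ (N + 1)) c (b ^ (N + 1))⁻¹
  have e4 : b⁻¹ * b ^ (N + 1) = b ^ N := by rw [pow_succ']; group
  have e5 : c⁻¹ * (b ^ (N + 1))⁻¹ = (c ^ (N + 2))⁻¹ := by rw [← hcN, pow_succ c (N + 1)]; group
  have e6 : b⁻¹ * (b ^ (N + 1))⁻¹ = (b ^ (N + 2))⁻¹ := by rw [pow_succ b (N + 1)]; group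
  have e7 : (b ^ (N + 1))⁻¹ * c = (c ^ N)⁻¹ := by rw [← hcN, e1]
  have e8 : (b ^ (N + 1))⁻¹ * (b ^ (N + 1))⁻¹ = (b ^ (2 * N + 2))⁻¹ := by
    rw [← mul_inv_rev, ← pow_add]; congr 2; ring
  rw [e4, e5, e6, e7, e8, hf.inv, hf.inv, hf.inv, hf.inv, hb, hb, hb] at h5
  have h6 := hf.nonneg (b⁻¹ * c)
  push_cast at *
  have h7 : f c ≤ (N + 1) * f b := by nlinarith
  rcases le_max_iff.1 h4 with h4 | h4 <;> rcases le_max_iff.1 h5 with h5 | h5 <;> nlinarith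

theorem invert {b c : G} (hr : 0 < f b) (hb : ∀ n : ℕ, f (b ^ n) = n * f b) {m : ℕ} (hm : 0 < m)
    (hc : c * b ^ m * c⁻¹ = (b ^ m)⁻¹) : f (c * c) = 0 := by
  obtain ⟨j, hj⟩ : ∃ j : ℕ, f c < j := ⟨(f c).toNat + 1, by push_cast; have := Int.self_le_toNat (f c); linarith⟩
  obtain ⟨N, hN⟩ : ∃ N, m * j = N := ⟨_, rfl⟩
  have hNj : (j : ℤ) ≤ N := by
    rw [← hN]; exact_mod_cast Nat.le_mul_of_pos_left _ hm
  set B := b ^ N with hB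
  have hcB : c * B * c⁻¹ = B⁻¹ := by
    rw [hB, ← hN, pow_mul, ← conj_pow, hc, inv_pow]
  have h1 : c * B = B⁻¹ * c := by rw [← hcB]; group
  have h2 : c * B⁻¹ = B * c := by
    have : c * B⁻¹ * c⁻¹ = B := by rw [← conj_inv, hcB, inv_inv]
    rw [← mul_inv_eq_iff_eq_mul, this]
  have hBr : f B = N * f b := hb N
  have hBB : f (B * B) = 2 * (N * f b) := by rw [hB, ← pow_add, hb]; push_cast; ring
  have hlt : f c < N * f b := by nlinarith [hf.nonneg c]
  have n1 := hf.nonneg c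
  have i1 : f (c⁻¹ * (B⁻¹ * c)) = f B := by rw [← h1]; simp
  have i2 : f (c⁻¹ * (B * c)) = f B := by rw [← h2]; simp [hf.inv]
  have i3 : f ((B * c)⁻¹ * (B⁻¹ * c)) = f (B * B) := by rw [← h1, ← h2]; simp [mul_assoc]
  have k1 := hf.fp4 c (B * c) B (B⁻¹ * c)
  have e1 : f ((B * c)⁻¹ * B) = f c := by simp [hf.inv]
  rw [i1, i2, i3, e1] at k1
  have k2 := hf.fp4 B⁻¹ B c (B⁻¹ * c)
  have e2 : f (B⁻¹⁻¹ * c) = f (c⁻¹ * B⁻¹) := hf.symm _ _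
  have e3 : f (B⁻¹⁻¹ * B) = f (B * B) := by simp
  have e4 : f (B⁻¹⁻¹ * (B⁻¹ * c)) = f c := by simp
  have e5 : f (B⁻¹ * c) = f (c⁻¹ * B) := hf.symm _ _
  rw [i1, e2, e3, e4, e5] at k2
  have k3 := hf.fp4 c B c⁻¹ B⁻¹
  have e6 : f (c⁻¹⁻¹ * B⁻¹) = f (c⁻¹ * B⁻¹) := by
    rw [inv_inv, h2, ← hf.inv]; simp
  have e7 : f (B⁻¹ * c⁻¹) = f (c⁻¹ * B) := by
    rw [← hf.inv, mul_inv_rev, inv_inv, inv_inv, h1, e5]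
  have e8 : f (c⁻¹ * c⁻¹) = f (c * c) := by rw [← mul_inv_rev, hf.inv]
  have e9 : f (B⁻¹ * B⁻¹) = f (B * B) := by rw [← mul_inv_rev, hf.inv]
  rw [e6, e7, e8, e9] at k3
  have n2 := hf.nonneg (c * c)
  have n3 := hf.mul_le c⁻¹ B
  rw [hf.inv] at n3
  have n4 := hf.nonneg (c⁻¹ * B)
  rw [hBr, hBB] at *
  rcases le_max_iff.1 k1 with k1 | k1 <;> rcases le_max_iff.1 k2 with k2 | k2 <;>
    rcases le_max_iff.1 k3 with k3 | k3 <;> linarith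

/-- twice the Gromov product -/
def _root_.gp2 (f : G → ℤ) (x y : G) : ℤ := f x + f y - f (x⁻¹ * y)

omit hf in
theorem gp_def (x y : G) : gp2 f x y = f x + f y - f (x⁻¹ * y) := rfl

theorem gp_min (x y z : G) : min (gp2 f x y) (gp2 f y z) ≤ gp2 f x z := by
  have := hf.fp x y z
  simp only [gp_def]
  omega

/-- Dichotomy -/
theorem dich {p q g : G} {r : ℤ} (hr : 0 < r) (hp : ∀ n : ℕ, f (p ^ n) = n * r)
    (hq : ∀ n : ℕ, f (q ^ n) = n * r)
    (h : ¬ ∃ K : ℤ, ∀ N M : ℕ, gp2 f (g⁻¹ * p ^ N) (q ^ M) ≤ K) (N : ℕ) :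
    f ((p ^ N)⁻¹ * g * q ^ N) ≤ 3 * f g := by
  push Not at h
  obtain ⟨N1, M1, h1⟩ := h (2 * (N * r) + 2 * f g)
  have n1 := hf.mul_le g⁻¹ (p ^ N1)
  have n2 := hf.nonneg g
  have n3 := hf.le_right g⁻¹ (p ^ N1)
  have n4 := hf.le_right (g⁻¹ * p ^ N1)⁻¹ (q ^ M1)
  have n5 := hf.le_left (g⁻¹ * p ^ N1)⁻¹ (q ^ M1)
  have n6 := hf.mul_le g⁻¹ (p ^ N)
  have n7 := hf.le_right g⁻¹ (p ^ N)
  have h1' := h1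
  rw [gp_def] at h1'
  rw [hf.inv, hp] at n1 n3
  rw [hf.inv, hp] at n6 n7
  rw [hf.inv, hq] at n4
  rw [hf.inv, hq] at n5
  rw [hq] at h1'
  have hM : N ≤ M1 := by
    have : (N : ℤ) * r ≤ M1 * r := by linarith
    exact_mod_cast le_of_mul_le_mul_right this hr
  have hN : N ≤ N1 := by
    have : (N : ℤ) * r ≤ N1 * r := by linarith
    exact_mod_cast le_of_mul_le_mul_right this hr
  obtain ⟨s, rfl⟩ := Nat.exists_eq_add_of_le hM
  obtain ⟨t, rfl⟩ := Nat.exists_eq_add_of_le hN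
  have m1 := hf.gp_min (g⁻¹ * p ^ N) (g⁻¹ * p ^ (N + t)) (q ^ (N + s))
  have m2 := hf.gp_min (g⁻¹ * p ^ N) (q ^ (N + s)) (q ^ N)
  have c1 : gp2 f (q ^ (N + s)) (q ^ N) = 2 * (N * r) := by
    rw [gp_def, hq, hq, hf.symm, pow_add, inv_mul_cancel_left, hq]; push_cast; ring
  have c2 : 2 * (N * r) - 2 * f g ≤ gp2 f (g⁻¹ * p ^ N) (g⁻¹ * p ^ (N + t)) := by
    have : (g⁻¹ * p ^ N)⁻¹ * (g⁻¹ * p ^ (N + t)) = p ^ t := by rw [pow_add]; group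
    rw [gp_def, this, hp]
    push_cast at n3
    linarith
  have c3 : gp2 f (g⁻¹ * p ^ N) (q ^ N) = f (g⁻¹ * p ^ N) + N * r - f ((p ^ N)⁻¹ * g * q ^ N) := by
    rw [gp_def, hq]; congr 2; group
  omega

end TreeLen
section RaagPart
open Classical
variable {A : Type} (Γ : SimpleGraph A)

/-- the group element of a word -/
noncomputable def wd (l : List (A × Bool)) : RAAG Γ := raagMk Γ (FreeGroup.mk l)

theorem wd_nil : wd Γ [] = 1 := by
  rw [wd, ← FreeGroup.one_eq_mk, map_one]

theorem wd_append (l m : List (A × Bool)) : wd Γ (l ++ m) = wd Γ l * wd Γ m := by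
  rw [wd, ← FreeGroup.mul_mk, map_mul]; rfl

theorem wd_cons (x : A × Bool) (m : List (A × Bool)) : wd Γ (x :: m) = wd Γ [x] * wd Γ m := by
  rw [← wd_append]; rfl

theorem wd_true (c : A) : wd Γ [(c, true)] = raagGen Γ c := rfl

theorem wd_false (c : A) : wd Γ [(c, false)] = (raagGen Γ c)⁻¹ := by
  rw [← wd_true, wd, wd, ← map_inv, FreeGroup.inv_mk]; rfl

theorem wd_not (c : A) (e : Bool) : wd Γ [(c, !e)] = (wd Γ [(c, e)])⁻¹ := by
  cases e <;> simp [wd_true, wd_false]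

theorem wd_surj (g : RAAG Γ) : ∃ l, wd Γ l = g := by
  obtain ⟨x, rfl⟩ := PresentedGroup.mk_surjective (raagRels Γ) g
  exact ⟨x.toWord, by rw [wd, FreeGroup.mk_toWord]; rfl⟩

theorem gen_comm {a c : A} (h : Γ.Adj a c) :
    raagGen Γ a * raagGen Γ c = raagGen Γ c * raagGen Γ a := by
  have : raagMk Γ (FreeGroup.of a * FreeGroup.of c * (FreeGroup.of a)⁻¹ * (FreeGroup.of c)⁻¹) = 1 :=
    PresentedGroup.one_of_mem ⟨a, c, h, rfl⟩
  simp only [map_mul, map_inv] at this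
  rw [mul_inv_eq_one, mul_inv_eq_iff_eq_mul] at this
  exact this

/-- homomorphisms out of a RAAG -/
noncomputable def raagLift {H : Type*} [Group H] (f : A → H)
    (hf : ∀ a c, Γ.Adj a c → f a * f c = f c * f a) : RAAG Γ →* H :=
  PresentedGroup.toGroup (f := f) (by
    rintro r ⟨a, c, h, rfl⟩
    simp only [map_mul, map_inv, FreeGroup.lift_apply_of]
    rw [mul_inv_eq_one, mul_inv_eq_iff_eq_mul, hf a c h])

theorem raagLift_gen {H : Type*} [Group H] (f : A → H)
    (hf : ∀ a c, Γ.Adj a c → f a * f c = f c * f a) (a : A) :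
    raagLift Γ f hf (raagGen Γ a) = f a :=
  PresentedGroup.toGroup.of _

/-- the subgroup generated by the link -/
def lk (a : A) : Subgroup (RAAG Γ) := Subgroup.closure {x | ∃ c, Γ.Adj a c ∧ x = raagGen Γ c}

theorem gen_mem_lk {a c : A} (h : Γ.Adj a c) : raagGen Γ c ∈ lk Γ a :=
  Subgroup.subset_closure ⟨c, h, rfl⟩

theorem lk_comm {a : A} {z : RAAG Γ} (hz : z ∈ lk Γ a) : raagGen Γ a * z = z * raagGen Γ a := by
  suffices h : lk Γ a ≤ Subgroup.centralizer {raagGen Γ a} from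
    Subgroup.mem_centralizer_iff.1 (h hz) _ rfl
  rw [lk, Subgroup.closure_le]
  rintro _ ⟨c, h, rfl⟩
  rw [SetLike.mem_coe, Subgroup.mem_centralizer_iff]
  rintro _ rfl
  exact gen_comm Γ h

/-- the action on the free group on the edges -/
noncomputable def act (a : A) : RAAG Γ →* MulAut (FreeGroup (RAAG Γ ⧸ lk Γ a)) where
  toFun g := FreeGroup.freeGroupCongr (MulAction.toPerm g)
  map_one' := by
    ext x
    induction x using FreeGroup.induction_on <;> simp_all
  map_mul' g h := by
    ext x
    rw [MulAut.mul_apply]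
    induction x using FreeGroup.induction_on <;> simp_all [mul_smul]

theorem act_of (a : A) (g : RAAG Γ) (x : RAAG Γ ⧸ lk Γ a) :
    act Γ a g (FreeGroup.of x) = FreeGroup.of (g • x) := by
  simp [act]

theorem act_mk (a : A) (g : RAAG Γ) (x : List ((RAAG Γ ⧸ lk Γ a) × Bool)) :
    act Γ a g (FreeGroup.mk x) = FreeGroup.mk (x.map fun y => (g • y.1, y.2)) := by
  simp [act]

theorem act_norm (a : A) (g : RAAG Γ) (x : FreeGroup (RAAG Γ ⧸ lk Γ a)) :
    (act Γ a g x).norm = x.norm := by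
  have h (g : RAAG Γ) (x : FreeGroup (RAAG Γ ⧸ lk Γ a)) : (act Γ a g x).norm ≤ x.norm := by
    conv_lhs => rw [← FreeGroup.mk_toWord (x := x), act_mk]
    refine FreeGroup.norm_mk_le.trans ?_
    simp [FreeGroup.norm]
  refine le_antisymm (h g x) ?_
  have := h g⁻¹ (act Γ a g x)
  rwa [← MulAut.mul_apply, ← map_mul, inv_mul_cancel, map_one, MulAut.one_apply] at this

/-- the homomorphism to the semidirect product -/
noncomputable def bigPhi (a : A) : RAAG Γ →* FreeGroup (RAAG Γ ⧸ lk Γ a) ⋊[act Γ a] RAAG Γ :=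
  raagLift Γ (fun c => ⟨if c = a then FreeGroup.of ((1 : RAAG Γ) : RAAG Γ ⧸ lk Γ a) else 1, raagGen Γ c⟩) (by
    have key : ∀ y, Γ.Adj a y → raagGen Γ y • ((1 : RAAG Γ) : RAAG Γ ⧸ lk Γ a) = ((1 : RAAG Γ) : RAAG Γ ⧸ lk Γ a) := by
      intro y hy
      rw [MulAction.Quotient.smul_coe, eq_comm, QuotientGroup.eq]
      simpa using gen_mem_lk Γ hy
    intro x y h
    ext
    · simp only [SemidirectProduct.mul_left]
      by_cases hx : x = a
      · subst hx
        have hy : y ≠ x := h.ne'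
        simp [hy, act_of, key y h]
      · by_cases hy : y = a
        · subst hy
          simp [hx, act_of, key x h.symm]
        · simp [hx, hy]
    · exact gen_comm Γ h)

theorem bigPhi_right (a : A) (g : RAAG Γ) : (bigPhi Γ a g).right = g := by
  have : (SemidirectProduct.rightHom.comp (bigPhi Γ a)) = MonoidHom.id _ := by
    apply PresentedGroup.ext
    intro x
    show (bigPhi Γ a (raagGen Γ x)).right = raagGen Γ x
    rw [bigPhi, raagLift_gen]
  exact DFunLike.congr_fun this g

/-- the crossed homomorphism -/
noncomputable def dd (a : A) (g : RAAG Γ) : FreeGroup (RAAG Γ ⧸ lk Γ a) := (bigPhi Γ a g).left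

theorem dd_one (a : A) : dd Γ a 1 = 1 := by simp [dd]

theorem dd_mul (a : A) (g h : RAAG Γ) : dd Γ a (g * h) = dd Γ a g * act Γ a g (dd Γ a h) := by
  simp [dd, bigPhi_right]

theorem dd_gen (a : A) : dd Γ a (raagGen Γ a) = FreeGroup.of ((1 : RAAG Γ) : RAAG Γ ⧸ lk Γ a) := by
  rw [dd, bigPhi, raagLift_gen]; simp

theorem dd_gen_ne {a c : A} (h : c ≠ a) : dd Γ a (raagGen Γ c) = 1 := by
  rw [dd, bigPhi, raagLift_gen]; simp [h]

theorem dd_inv (a : A) (g : RAAG Γ) : dd Γ a g⁻¹ = act Γ a g⁻¹ (dd Γ a g)⁻¹ := by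
  rw [dd, map_inv, SemidirectProduct.inv_left, bigPhi_right]; rfl

/-- the `a`-length -/
noncomputable def al (a : A) (g : RAAG Γ) : ℤ := (dd Γ a g).norm

theorem al_inv_mul (a : A) (g h : RAAG Γ) : al Γ a (g⁻¹ * h) = ((dd Γ a g)⁻¹ * dd Γ a h).norm := by
  rw [al, dd_mul, dd_inv, ← map_mul, act_norm]

theorem al_tree (a : A) : TreeLen (al Γ a) where
  one := by simp [al, dd_one]
  nonneg g := by simp [al]
  inv g := by
    rw [al, dd_inv, act_norm, FreeGroup.norm_inv_eq]; rfl
  mul_le g h := by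
    rw [al, dd_mul]
    have := FreeGroup.norm_mul_le (dd Γ a g) (act Γ a g (dd Γ a h))
    rw [act_norm] at this
    unfold al
    exact_mod_cast this
  fp x y z := by
    rw [al_inv_mul, al_inv_mul, al_inv_mul]
    exact norm_fp _ _ _

theorem al_gen_ne {a c : A} (h : c ≠ a) : al Γ a (raagGen Γ c) = 0 := by
  simp [al, dd_gen_ne Γ h]

theorem al_gen (a : A) : al Γ a (raagGen Γ a) = 1 := by
  simp [al, dd_gen Γ]

theorem al_letter_ne {a c : A} (e : Bool) (h : c ≠ a) : al Γ a (wd Γ [(c, e)]) = 0 := by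
  cases e
  · rw [wd_false, (al_tree Γ a).inv, al_gen_ne Γ h]
  · rw [wd_true, al_gen_ne Γ h]

theorem al_letter (a : A) (e : Bool) : al Γ a (wd Γ [(a, e)]) = 1 := by
  cases e
  · rw [wd_false, (al_tree Γ a).inv, al_gen Γ]
  · rw [wd_true, al_gen Γ]

theorem al_lk {a c : A} (h : ¬ Γ.Adj a c) {z : RAAG Γ} (hz : z ∈ lk Γ a) : al Γ c z = 0 := by
  have H := al_tree Γ c
  induction hz using Subgroup.closure_induction with
  | mem x hx =>
    obtain ⟨y, hy, rfl⟩ := hx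
    exact al_gen_ne Γ (by rintro rfl; exact h hy)
  | one => exact H.one
  | mul x y _ _ hx hy =>
    have := H.mul_le x y
    have := H.nonneg (x * y)
    linarith
  | inv x _ hx => rw [H.inv, hx]

/-- number of occurrences of `a` -/
noncomputable def cnt (a : A) (l : List (A × Bool)) : ℕ := (l.map Prod.fst).count a

theorem cnt_nil (a : A) : cnt a [] = 0 := rfl
theorem cnt_append (a : A) (l m : List (A × Bool)) : cnt a (l ++ m) = cnt a l + cnt a m := by
  simp [cnt]
theorem cnt_cons_self (a : A) (e : Bool) (m : List (A × Bool)) : cnt a ((a, e) :: m) = cnt a m + 1 := by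
  simp [cnt]
theorem cnt_cons_ne {a c : A} (h : c ≠ a) (e : Bool) (m : List (A × Bool)) : cnt a ((c, e) :: m) = cnt a m := by
  simp [cnt, h]
theorem cnt_pos {a : A} {l : List (A × Bool)} (h : cnt a l ≠ 0) : ∃ u e v, l = u ++ (a, e) :: v := by
  have : a ∈ l.map Prod.fst := List.count_pos_iff.1 (Nat.pos_of_ne_zero h)
  obtain ⟨⟨a', e⟩, hm, rfl⟩ := List.mem_map.1 this
  obtain ⟨u, v, rfl⟩ := List.append_of_mem hm
  exact ⟨u, e, v, rfl⟩

theorem al_le_cnt (a : A) (l : List (A × Bool)) : al Γ a (wd Γ l) ≤ cnt a l := by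
  have H := al_tree Γ a
  induction l with
  | nil => simp [wd_nil, H.one]
  | cons x l ih =>
    obtain ⟨c, e⟩ := x
    rw [wd_cons]
    have := H.mul_le (wd Γ [(c, e)]) (wd Γ l)
    by_cases h : c = a
    · subst h
      rw [cnt_cons_self]; rw [al_letter] at this; push_cast; linarith
    · rw [cnt_cons_ne h]; rw [al_letter_ne Γ e h] at this; linarith

/-- base point of the edge crossed by the letter `a^e` starting at `g` -/
noncomputable def eb (a : A) (g : RAAG Γ) (e : Bool) : RAAG Γ := if e then g else g * (raagGen Γ a)⁻¹

/-- the list of edges crossed -/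
noncomputable def dl (a : A) : RAAG Γ → List (A × Bool) → List ((RAAG Γ ⧸ lk Γ a) × Bool)
  | _, [] => []
  | g, (c, e) :: l =>
    if c = a then ((eb Γ a g e : RAAG Γ ⧸ lk Γ a), e) :: dl a (g * wd Γ [(c, e)]) l
    else dl a (g * wd Γ [(c, e)]) l

theorem dl_cons_self (a : A) (g : RAAG Γ) (e : Bool) (l : List (A × Bool)) :
    dl Γ a g ((a, e) :: l) = ((eb Γ a g e : RAAG Γ ⧸ lk Γ a), e) :: dl Γ a (g * wd Γ [(a, e)]) l := by
  simp [dl]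

theorem dl_cons_ne {a c : A} (h : c ≠ a) (g : RAAG Γ) (e : Bool) (l : List (A × Bool)) :
    dl Γ a g ((c, e) :: l) = dl Γ a (g * wd Γ [(c, e)]) l := by
  simp [dl, h]

theorem dl_length (a : A) (l : List (A × Bool)) : ∀ g, (dl Γ a g l).length = cnt a l := by
  induction l with
  | nil => intro g; rfl
  | cons x l ih =>
    intro g
    obtain ⟨c, e⟩ := x
    by_cases h : c = a
    · subst h; rw [dl_cons_self, cnt_cons_self, List.length_cons, ih]
    · rw [dl_cons_ne Γ h, cnt_cons_ne h, ih]

theorem mk_dl (a : A) (l : List (A × Bool)) : ∀ g,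
    FreeGroup.mk (dl Γ a g l) = act Γ a g (dd Γ a (wd Γ l)) := by
  induction l with
  | nil => intro g; rw [wd_nil, dd_one, map_one]; rfl
  | cons x l ih =>
    intro g
    obtain ⟨c, e⟩ := x
    rw [wd_cons, dd_mul, map_mul, ← MulAut.mul_apply, ← map_mul, ← ih]
    by_cases h : c = a
    · subst h
      rw [dl_cons_self]
      rw [← List.singleton_append, ← FreeGroup.mul_mk]
      congr 1
      cases e
      · rw [wd_false, dd_inv, dd_gen, map_inv, act_of, map_inv, act_of, FreeGroup.of, FreeGroup.inv_mk]
        simp [eb, FreeGroup.invRev]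
      · rw [wd_true, dd_gen, act_of, FreeGroup.of]
        simp [eb]
    · rw [dl_cons_ne Γ h]
      have : dd Γ a (wd Γ [(c, e)]) = 1 := by
        have := al_letter_ne Γ e h
        rw [al] at this
        exact FreeGroup.norm_eq_zero.1 (by exact_mod_cast this)
      rw [this, map_one, one_mul]

theorem dl_head (a : A) (l : List (A × Bool)) : ∀ g y t, dl Γ a g l = y :: t →
    ∃ h w, l = h ++ (a, y.2) :: w ∧ cnt a h = 0 ∧
      y.1 = (eb Γ a (g * wd Γ h) y.2 : RAAG Γ ⧸ lk Γ a) := by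
  induction l with
  | nil => intro g y t h; simp [dl] at h
  | cons x l ih =>
    intro g y t H
    obtain ⟨c, e⟩ := x
    by_cases h : c = a
    · subst h
      rw [dl_cons_self] at H
      obtain ⟨rfl, -⟩ := List.cons_eq_cons.1 H
      exact ⟨[], l, rfl, rfl, by simp [wd_nil]⟩
    · rw [dl_cons_ne Γ h] at H
      obtain ⟨u, w, rfl, h2, h3⟩ := ih _ _ _ H
      refine ⟨(c, e) :: u, w, rfl, by rw [cnt_cons_ne h, h2], ?_⟩
      rw [h3, wd_cons Γ _ u, mul_assoc]

/-- retraction onto the subgroup generated by a set of vertices -/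
noncomputable def ret (S : Set A) : RAAG Γ →* RAAG Γ :=
  raagLift Γ (fun c => if c ∈ S then raagGen Γ c else 1) (by
    intro a c h
    by_cases ha : a ∈ S <;> by_cases hc : c ∈ S <;> simp [ha, hc, gen_comm Γ h])

theorem ret_gen_mem {S : Set A} {c : A} (h : c ∈ S) : ret Γ S (raagGen Γ c) = raagGen Γ c := by
  rw [ret, raagLift_gen, if_pos h]

theorem ret_gen_not {S : Set A} {c : A} (h : c ∉ S) : ret Γ S (raagGen Γ c) = 1 := by
  rw [ret, raagLift_gen, if_neg h]

theorem ret_letter_mem {S : Set A} {c : A} (e : Bool) (h : c ∈ S) : ret Γ S (wd Γ [(c, e)]) = wd Γ [(c, e)] := by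
  cases e <;> simp [wd_true, wd_false, ret_gen_mem Γ h]

theorem ret_letter_not {S : Set A} {c : A} (e : Bool) (h : c ∉ S) : ret Γ S (wd Γ [(c, e)]) = 1 := by
  cases e <;> simp [wd_true, wd_false, ret_gen_not Γ h]

theorem al_ret_not {S : Set A} {a : A} (h : a ∉ S) (g : RAAG Γ) : al Γ a (ret Γ S g) = 0 := by
  have H := al_tree Γ a
  obtain ⟨l, rfl⟩ := wd_surj Γ g
  induction l with
  | nil => simp [wd_nil, H.one]
  | cons x l ih =>
    obtain ⟨c, e⟩ := x
    rw [wd_cons, map_mul]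
    have h1 := H.mul_le (ret Γ S (wd Γ [(c, e)])) (ret Γ S (wd Γ l))
    have h2 := H.nonneg (ret Γ S (wd Γ [(c, e)]) * ret Γ S (wd Γ l))
    by_cases hc : c ∈ S
    · rw [ret_letter_mem Γ e hc] at *
      rw [al_letter_ne Γ e (by rintro rfl; exact h hc)] at h1
      linarith
    · rw [ret_letter_not Γ e hc] at *
      rw [H.one] at h1
      linarith

theorem lk_of_conj {a : A} {l : List (A × Bool)} (h0 : cnt a l = 0)
    (h : raagGen Γ a * wd Γ l * (raagGen Γ a)⁻¹ ∈ lk Γ a) : wd Γ l ∈ lk Γ a := by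
  have h1 : ∀ z ∈ lk Γ a, ret Γ {c | c ≠ a} z = z := by
    intro z hz
    induction hz using Subgroup.closure_induction with
    | mem x hx =>
      obtain ⟨y, hy, rfl⟩ := hx
      exact ret_gen_mem Γ hy.ne'
    | one => simp
    | mul x y _ _ hx hy => rw [map_mul, hx, hy]
    | inv x _ hx => rw [map_inv, hx]
  have h2 : ∀ l : List (A × Bool), cnt a l = 0 → ret Γ {c | c ≠ a} (wd Γ l) = wd Γ l := by
    intro l
    induction l with
    | nil => simp [wd_nil]
    | cons x l ih =>
      obtain ⟨c, e⟩ := x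
      intro h
      by_cases hc : c = a
      · subst hc; rw [cnt_cons_self] at h; omega
      · rw [cnt_cons_ne hc] at h
        rw [wd_cons, map_mul, ih h, ret_letter_mem Γ e hc]
  have h3 := h1 _ h
  rw [map_mul, map_mul, map_inv, h2 l h0, ret_gen_not Γ (by simp)] at h3
  simp only [one_mul, inv_one, mul_one] at h3
  rw [h3]; exact h

/-- Britton's lemma -/
theorem britton (a : A) (l : List (A × Bool)) : ∀ g, ¬ FreeGroup.IsReduced (dl Γ a g l) →
    ∃ u e h v, l = u ++ (a, e) :: (h ++ (a, !e) :: v) ∧ wd Γ h ∈ lk Γ a := by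
  induction l with
  | nil => intro g h; exact absurd FreeGroup.IsReduced.nil h
  | cons x l ih =>
    intro g H
    obtain ⟨c, e⟩ := x
    by_cases hc : c = a
    · subst hc
      rw [dl_cons_self] at H
      by_cases hr : FreeGroup.IsReduced (dl Γ c (g * wd Γ [(c, e)]) l)
      · rcases hd : dl Γ c (g * wd Γ [(c, e)]) l with _ | ⟨y, t⟩
        · rw [hd] at H; exact absurd FreeGroup.IsReduced.singleton H
        · rw [hd] at H hr
          rw [FreeGroup.isReduced_cons_cons] at H
          have h1 : (eb Γ c g e : RAAG Γ ⧸ lk Γ c) = y.1 ∧ e ≠ y.2 := by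
            by_contra h2
            apply H
            exact ⟨fun h3 => by by_contra h4; exact h2 ⟨h3, h4⟩, hr⟩
          obtain ⟨h, w, rfl, h0, h3⟩ := dl_head Γ c l _ _ _ hd
          obtain ⟨h1, h2⟩ := h1
          have h4 : y.2 = !e := by revert h2; cases e <;> cases y.2 <;> simp
          rw [h4] at h3 ⊢
          rw [h3, QuotientGroup.eq] at h1
          refine ⟨[], e, h, w, rfl, ?_⟩
          cases e
          · rw [wd_false] at h1
            simpa [eb, mul_assoc] using h1
          · rw [wd_true] at h1
            apply lk_of_conj Γ h0
            simpa [eb, mul_assoc] using h1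
      · obtain ⟨u, e', h, v, rfl, h1⟩ := ih _ hr
        exact ⟨(c, e) :: u, e', h, v, rfl, h1⟩
    · rw [dl_cons_ne Γ hc] at H
      obtain ⟨u, e', h, v, rfl, h1⟩ := ih _ H
      exact ⟨(c, e) :: u, e', h, v, rfl, h1⟩

end RaagPart
section GeoPart
open Classical
variable {A : Type} (Γ : SimpleGraph A)

/-- geodesic words -/
def Geo (l : List (A × Bool)) : Prop := ∀ m, wd Γ m = wd Γ l → l.length ≤ m.length

theorem raagLen_le (l : List (A × Bool)) : raagLen Γ (wd Γ l) ≤ l.length :=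
  Nat.sInf_le ⟨l, rfl, rfl⟩

theorem exists_len (g : RAAG Γ) : ∃ l, wd Γ l = g ∧ l.length = raagLen Γ g := by
  obtain ⟨l, hl⟩ := wd_surj Γ g
  have : {m | ∃ l : List (A × Bool), l.length = m ∧ raagMk Γ (FreeGroup.mk l) = g}.Nonempty :=
    ⟨l.length, l, rfl, hl⟩
  obtain ⟨l', h1, h2⟩ := Nat.sInf_mem this
  exact ⟨l', h2, h1⟩

theorem geo_of_len {l : List (A × Bool)} (h : l.length = raagLen Γ (wd Γ l)) : Geo Γ l := by
  intro m hm
  rw [h, ← hm]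
  exact raagLen_le Γ m

theorem Geo.len {l : List (A × Bool)} (h : Geo Γ l) : l.length = raagLen Γ (wd Γ l) := by
  obtain ⟨m, h1, h2⟩ := exists_len Γ (wd Γ l)
  have := h m h1
  have := raagLen_le Γ l
  omega

theorem exists_geo (g : RAAG Γ) : ∃ l, wd Γ l = g ∧ Geo Γ l := by
  obtain ⟨l, rfl, h⟩ := exists_len Γ g
  exact ⟨l, rfl, geo_of_len Γ h⟩

theorem pinch {a : A} {e : Bool} {h : List (A × Bool)} (hh : wd Γ h ∈ lk Γ a) (u v : List (A × Bool)) :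
    wd Γ (u ++ (a, e) :: (h ++ (a, !e) :: v)) = wd Γ u * wd Γ h * wd Γ v := by
  rw [wd_append, wd_cons, wd_append, wd_cons Γ (a, !e), wd_not]
  have h1 : Commute (wd Γ [(a, e)]) (wd Γ h) := by
    have h2 : Commute (raagGen Γ a) (wd Γ h) := lk_comm Γ hh
    cases e
    · rw [wd_false]; exact h2.inv_left
    · exact h2
  rw [← mul_assoc (wd Γ [(a, e)]), h1.eq]
  group

theorem Geo.no_pinch {a : A} {e : Bool} {u h v : List (A × Bool)}
    (hg : Geo Γ (u ++ (a, e) :: (h ++ (a, !e) :: v))) : wd Γ h ∉ lk Γ a := by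
  intro hh
  have := hg (u ++ h ++ v) (by rw [pinch Γ hh, wd_append, wd_append])
  simp at this

theorem cnt_of_reduced {a : A} {l : List (A × Bool)} (g : RAAG Γ) (h : FreeGroup.IsReduced (dl Γ a g l)) :
    al Γ a (wd Γ l) = cnt a l := by
  rw [al, ← act_norm Γ a g, ← mk_dl, FreeGroup.norm, FreeGroup.toWord_mk, h.reduce_eq, dl_length]

theorem Geo.red {a : A} {l : List (A × Bool)} (hg : Geo Γ l) (g : RAAG Γ) : FreeGroup.IsReduced (dl Γ a g l) := by
  by_contra h
  obtain ⟨u, e, h, v, rfl, h1⟩ := britton Γ a l g h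
  exact hg.no_pinch Γ h1

theorem Geo.al {a : A} {l : List (A × Bool)} (hg : Geo Γ l) : al Γ a (wd Γ l) = cnt a l :=
  cnt_of_reduced Γ 1 (hg.red Γ 1)

theorem Geo.tail {x : A × Bool} {l : List (A × Bool)} (hg : Geo Γ (x :: l)) : Geo Γ l := by
  intro m hm
  have := hg (x :: m) (by rw [wd_cons, hm, ← wd_cons])
  simpa using this

theorem eq_one_of_al {g : RAAG Γ} (h : ∀ a, al Γ a g = 0) : g = 1 := by
  obtain ⟨l, rfl, hl⟩ := exists_geo Γ g
  rcases l with _ | ⟨⟨c, e⟩, l⟩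
  · exact wd_nil Γ
  · have := h c
    rw [hl.al, cnt_cons_self] at this
    push_cast at this
    omega

theorem length_eq_sum [Fintype A] (l : List (A × Bool)) : ∑ a, cnt a l = l.length := by
  have := Multiset.sum_count_eq_card (s := Finset.univ) (m := ((l.map Prod.fst : List A) : Multiset A)) (by simp)
  simpa [cnt] using this

theorem len_eq_sum [Fintype A] (g : RAAG Γ) : (raagLen Γ g : ℤ) = ∑ a, al Γ a g := by
  obtain ⟨l, rfl, hl⟩ := exists_geo Γ g
  rw [← hl.len, ← length_eq_sum]
  push_cast
  exact Finset.sum_congr rfl fun a _ => (hl.al Γ).symm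

theorem additive_transfer {a a' : A} (hne : a' ≠ a) (hadj : ¬ Γ.Adj a a') (e : Bool) (p q : RAAG Γ)
    (h : al Γ a' p + 1 + al Γ a' q ≤ al Γ a' (p * wd Γ [(a', e)] * q)) :
    al Γ a p + al Γ a q ≤ al Γ a (p * wd Γ [(a', e)] * q) := by
  obtain ⟨wp, rfl, hp⟩ := exists_geo Γ p
  obtain ⟨wq, rfl, hq⟩ := exists_geo Γ q
  have E : wd Γ wp * wd Γ [(a', e)] * wd Γ wq = wd Γ (wp ++ (a', e) :: wq) := by
    rw [wd_append, wd_cons Γ _ wq, mul_assoc]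
  rw [E] at h ⊢
  rw [hp.al, hq.al] at *
  by_cases hr : FreeGroup.IsReduced (dl Γ a 1 (wp ++ (a', e) :: wq))
  · rw [cnt_of_reduced Γ 1 hr, cnt_append, cnt_cons_ne hne]; push_cast; rfl
  · exfalso
    obtain ⟨u, e1, z, v, hl, hz⟩ := britton Γ a _ 1 hr
    have hc : cnt a' z = 0 := by
      have h1 : al Γ a' (wd Γ (wp ++ (a', e) :: wq)) ≤ cnt a' u + cnt a' v := by
        rw [hl, pinch Γ hz]
        have H := al_tree Γ a'
        have h2 := H.mul_le (wd Γ u * wd Γ z) (wd Γ v)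
        have h3 := H.mul_le (wd Γ u) (wd Γ z)
        rw [al_lk Γ hadj hz] at h3
        have h4 := al_le_cnt Γ a' u
        have h5 := al_le_cnt Γ a' v
        linarith
      have h6 := congrArg (cnt a') hl
      rw [cnt_append, cnt_cons_self, cnt_append, cnt_cons_ne hne.symm, cnt_append, cnt_cons_ne hne.symm] at h6
      omega
    rcases List.append_eq_append_iff.1 hl with ⟨t, h1, h2⟩ | ⟨t, h1, h2⟩
    · rcases t with _ | ⟨x, t⟩
      · simp only [List.nil_append, List.cons.injEq, Prod.mk.injEq] at h2
        exact hne h2.1.1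
      · simp only [List.cons_append, List.cons.injEq] at h2
        rw [h2.2] at hq
        exact hq.no_pinch Γ hz
    · rcases t with _ | ⟨x, t⟩
      · simp only [List.nil_append, List.cons.injEq, Prod.mk.injEq] at h2
        exact hne h2.1.1.symm
      · simp only [List.cons_append, List.cons.injEq] at h2
        obtain ⟨rfl, h2⟩ := h2
        rcases List.append_eq_append_iff.1 h2 with ⟨s, h3, h4⟩ | ⟨s, h3, h4⟩
        · rcases s with _ | ⟨y, s⟩
          · simp only [List.nil_append, List.cons.injEq, Prod.mk.injEq] at h4
            exact hne h4.1.1.symm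
          · simp only [List.cons_append, List.cons.injEq] at h4
            rw [h1, h3, ← h4.1] at hp
            exact hp.no_pinch Γ hz
        · rcases s with _ | ⟨y, s⟩
          · simp only [List.nil_append, List.cons.injEq, Prod.mk.injEq] at h4
            exact hne h4.1.1
          · simp only [List.cons_append, List.cons.injEq] at h4
            rw [h3, ← h4.1, cnt_append, cnt_cons_self] at hc
            omega

/-- exponent sum -/
noncomputable def expo (a : A) : RAAG Γ →* Multiplicative ℤ :=
  raagLift Γ (fun c => if c = a then Multiplicative.ofAdd 1 else 1) (fun _ _ _ => mul_comm _ _)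

theorem expo_parity (a : A) (l : List (A × Bool)) :
    ∃ k : ℤ, Multiplicative.toAdd (expo Γ a (wd Γ l)) = cnt a l + 2 * k := by
  induction l with
  | nil => exact ⟨0, by simp [wd_nil, cnt_nil]⟩
  | cons x l ih =>
    obtain ⟨k, ih⟩ := ih
    obtain ⟨c, e⟩ := x
    rw [wd_cons, map_mul, toAdd_mul, ih]
    by_cases h : c = a
    · subst h
      rw [cnt_cons_self]
      cases e
      · exact ⟨k - 1, by rw [wd_false, map_inv, expo, raagLift_gen]; simp; ring⟩
      · exact ⟨k, by rw [wd_true, expo, raagLift_gen]; simp; ring⟩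
    · rw [cnt_cons_ne h]
      refine ⟨k, ?_⟩
      cases e
      · rw [wd_false, map_inv, expo, raagLift_gen]; simp [h]
      · rw [wd_true, expo, raagLift_gen]; simp [h]

theorem raag_sq_eq_one [Fintype A] : ∀ (n : ℕ) (g : RAAG Γ), raagLen Γ g ≤ n → g * g = 1 → g = 1 := by
  intro n
  induction n with
  | zero =>
    intro g hg _
    obtain ⟨l, rfl, hl⟩ := exists_geo Γ g
    rw [← hl.len] at hg
    rw [List.eq_nil_of_length_eq_zero (by omega : l.length = 0), wd_nil]
  | succ n ih =>
    intro g hg h2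
    obtain ⟨l, rfl, hl⟩ := exists_geo Γ g
    rcases l with _ | ⟨⟨a, e⟩, l⟩
    · exact wd_nil Γ
    set x := wd Γ [(a, e)] with hx
    have hinv : (wd Γ ((a, e) :: l))⁻¹ = wd Γ ((a, e) :: l) := inv_eq_of_mul_eq_one_left h2
    have hx1 : al Γ a x = 1 := al_letter Γ a e
    have hxl : x⁻¹ * wd Γ ((a, e) :: l) = wd Γ l := by rw [wd_cons]; simp [hx]
    have c1 : al Γ a (wd Γ ((a, e) :: l)) = cnt a l + 1 := by rw [hl.al, cnt_cons_self]; push_cast; rfl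
    have c2 : al Γ a (wd Γ l) = cnt a l := (hl.tail Γ).al Γ
    have c3 : cnt a l ≠ 0 := by
      obtain ⟨k, hk⟩ := expo_parity Γ a ((a, e) :: l)
      have h3 := congrArg (fun z => Multiplicative.toAdd (expo Γ a z)) h2
      simp only [map_mul, toAdd_mul, map_one, toAdd_one] at h3
      rw [hk, cnt_cons_self] at h3
      push_cast at h3
      omega
    set g := wd Γ ((a, e) :: l) with hgd
    have key : ∀ c, al Γ c (x⁻¹ * g * x) ≤ al Γ c g ∧ (c = a → al Γ c (x⁻¹ * g * x) < al Γ c g) := by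
      intro c
      by_cases hc : c = a
      · subst hc
        have H := al_tree Γ c
        have f := H.fp4 x 1 (g * x) g
        have e1 : (g * x)⁻¹ * g = x⁻¹ := by group
        have e2 : x⁻¹ * (g * x) = x⁻¹ * g * x := by group
        have e3 : al Γ c (g * x) = al Γ c (x⁻¹ * g) := by rw [← H.inv, mul_inv_rev, hinv]
        have e4 : al Γ c (x⁻¹ * g) = cnt c l := by rw [hxl, c2]
        rw [e1, e2, inv_one, one_mul, one_mul, e3, mul_one, e4, H.inv, c1, hx1] at f
        have : al Γ c (x⁻¹ * g * x) < al Γ c g := by rw [c1]; omega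
        exact ⟨this.le, fun _ => this⟩
      · have H := al_tree Γ c
        have h0 : al Γ c x = 0 := al_letter_ne Γ e (Ne.symm hc)
        have f1 := H.mul_le (x⁻¹ * g) x
        have f2 := H.mul_le x⁻¹ g
        rw [H.inv] at f2
        exact ⟨by linarith, fun h => absurd h hc⟩
    have hlt : (raagLen Γ (x⁻¹ * g * x) : ℤ) < raagLen Γ g := by
      rw [len_eq_sum, len_eq_sum]
      exact Finset.sum_lt_sum (fun c _ => (key c).1) ⟨a, Finset.mem_univ _, (key a).2 rfl⟩
    have h3 := ih (x⁻¹ * g * x) (by omega) (by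
      rw [show x⁻¹ * g * x * (x⁻¹ * g * x) = x⁻¹ * (g * g) * x by group, h2]; group)
    have : g = x * (x⁻¹ * g * x) * x⁻¹ := by group
    rw [this, h3]; group

end GeoPart
section KeyPart
open Classical
variable {A : Type} (Γ : SimpleGraph A)

theorem propagate {β β' g : RAAG Γ} {a a' : A} (hne : a' ≠ a) (hadj : ¬ Γ.Adj a a') {r r' : ℤ}
    (hr : 0 < r) (hr' : 0 < r')
    (h1 : ∀ n : ℕ, al Γ a (β ^ n) = n * r) (h2 : ∀ n : ℕ, al Γ a (β' ^ n) = n * r)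
    (h1' : ∀ n : ℕ, al Γ a' (β ^ n) = n * r')
    (hK : ∃ K : ℤ, ∀ N M : ℕ, gp2 (al Γ a') (g⁻¹ * β ^ N) (β' ^ M) ≤ K) :
    ∃ K : ℤ, ∀ N M : ℕ, gp2 (al Γ a) (g⁻¹ * β ^ N) (β' ^ M) ≤ K := by
  by_contra h
  have D := (al_tree Γ a).dich hr h1 h2 h
  have H := al_tree Γ a'
  have Ha := al_tree Γ a
  obtain ⟨K, hK⟩ := hK
  obtain ⟨W, hW, hWg⟩ := exists_geo Γ β⁻¹
  have hc : (cnt a' W : ℤ) = r' := by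
    rw [← hWg.al, hW, H.inv]
    have := h1' 1
    simpa using this
  obtain ⟨w1, e, w2, rfl⟩ := cnt_pos (a := a') (l := W) (by intro h0; rw [h0] at hc; simp at hc; omega)
  rw [cnt_append, cnt_cons_self] at hc
  push_cast at hc
  obtain ⟨k, hk⟩ : ∃ k : ℕ, K + 2 * al Γ a' g < 2 * (k * r') := by
    refine ⟨(K + 2 * al Γ a' g).toNat + 1, ?_⟩
    have := Int.self_le_toNat (K + 2 * al Γ a' g)
    push_cast
    nlinarith
  have key : ∀ n : ℕ, (n : ℤ) * r ≤ 3 * al Γ a g + al Γ a (wd Γ w1) := by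
    intro n
    obtain ⟨N, hN⟩ : ∃ N, N = n + 1 + k := ⟨_, rfl⟩
    set z := g * β' ^ N with hz
    set y := (β ^ k)⁻¹ with hy
    set u := (β ^ (n + 1))⁻¹ with hu
    have A1 := hK k N
    rw [TreeLen.gp_def, show (g⁻¹ * β ^ k)⁻¹ * β' ^ N = y * z by rw [hz, hy]; group] at A1
    have A2 := H.le_right g⁻¹ (β ^ k)
    have A3 := H.mul_le g (β' ^ N)
    rw [H.inv] at A2
    rw [h1' k] at A2
    rw [← hz] at A3
    have B := H.gp_min (β ^ (n + 1)) (y * z) y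
    have fy : al Γ a' y = k * r' := by rw [hy, H.inv, h1']
    have fu : al Γ a' u = ((n + 1 : ℕ) : ℤ) * r' := by rw [hu, H.inv, h1']
    have fuy : al Γ a' (u * y) = (N : ℤ) * r' := by
      rw [hu, hy, ← mul_inv_rev, ← pow_add, H.inv, h1', hN, add_comm]
    simp only [TreeLen.gp_def] at B
    rw [← hu, h1' (n + 1), show (y * z)⁻¹ * y = z⁻¹ by group, H.inv z, fuy, fy] at B
    have B2 : ((n + 1 : ℕ) : ℤ) * r' + al Γ a' (y * z) ≤ al Γ a' (u * (y * z)) := by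
      rw [hN] at B
      push_cast at B ⊢
      rcases min_le_iff.1 B with B | B
      · nlinarith
      · nlinarith
    have T := additive_transfer Γ hne hadj e ((β ^ n)⁻¹ * wd Γ w1) (wd Γ w2 * (y * z))
    have E1 : (β ^ n)⁻¹ * wd Γ w1 * wd Γ [(a', e)] * (wd Γ w2 * (y * z)) = u * (y * z) := by
      rw [wd_append, wd_cons] at hW
      rw [hu, pow_succ', mul_inv_rev, show (β^n)⁻¹ * β⁻¹ = (β^n)⁻¹ * (wd Γ w1 * (wd Γ [(a', e)] * wd Γ w2)) by rw [hW]]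
      group
    have E2 : u * (y * z) = (β ^ N)⁻¹ * g * β' ^ N := by
      rw [hu, hy, hz, ← mul_assoc, ← mul_inv_rev, ← pow_add, ← mul_assoc, hN, add_comm k]
    rw [E1] at T
    have p1 := H.mul_le (β ^ n)⁻¹ (wd Γ w1)
    have p2 := H.mul_le (wd Γ w2) (y * z)
    have p3 := al_le_cnt Γ a' w1
    have p4 := al_le_cnt Γ a' w2
    rw [H.inv, h1'] at p1
    push_cast at B2
    have T2 := T (by nlinarith)
    rw [E2] at T2
    have T3 := D N
    have T4 := Ha.le_left (β ^ n)⁻¹ (wd Γ w1)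
    rw [Ha.inv, h1] at T4
    have T5 := Ha.nonneg (wd Γ w2 * (y * z))
    linarith
  have k1 := key ((3 * al Γ a g + al Γ a (wd Γ w1)).toNat + 1)
  have := Int.self_le_toNat (3 * al Γ a g + al Γ a (wd Γ w1))
  push_cast at k1
  nlinarith

theorem pigeon [Fintype A] {β β' g : RAAG Γ} {L : ℕ}
    (h : ∀ N : ℕ, raagLen Γ ((β ^ N)⁻¹ * g * β' ^ N) ≤ L) :
    ∃ m : ℕ, 0 < m ∧ β ^ m * g = g * β' ^ m := by
  have fin : {x : RAAG Γ | raagLen Γ x ≤ L}.Finite := by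
    refine ((List.finite_length_le (A × Bool) L).image (wd Γ)).subset ?_
    intro x hx
    obtain ⟨l, h1, h2⟩ := exists_len Γ x
    exact ⟨l, by simpa [h2] using hx, h1⟩
  have aux : ∀ N1 N2 : ℕ, N1 < N2 → (β ^ N1)⁻¹ * g * β' ^ N1 = (β ^ N2)⁻¹ * g * β' ^ N2 →
      ∃ m : ℕ, 0 < m ∧ β ^ m * g = g * β' ^ m := by
    intro N1 N2 hlt he
    obtain ⟨m, rfl⟩ := Nat.exists_eq_add_of_lt hlt
    refine ⟨m + 1, by omega, ?_⟩
    rw [add_assoc, pow_add, add_comm N1, pow_add β' (m+1)] at he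
    have : β ^ (m+1) * g = β ^ (m+1) * β ^ N1 * ((β ^ N1)⁻¹ * g * β' ^ N1) * (β' ^ N1)⁻¹ := by group
    rw [this, he, ← pow_add, add_comm (m+1), pow_add]; group
  have hni : ¬ Function.Injective (fun N : ℕ => (β ^ N)⁻¹ * g * β' ^ N) := by
    intro hi
    exact Set.infinite_range_of_injective hi (fin.subset (by rintro _ ⟨N, rfl⟩; exact h N))
  rw [Function.Injective] at hni
  push Not at hni
  obtain ⟨N1, N2, he, hn⟩ := hni
  rcases lt_or_gt_of_ne hn with hlt | hlt
  · exact aux _ _ hlt he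
  · exact aux _ _ hlt he.symm

theorem dl_first {a : A} : ∀ (l : List (A × Bool)), cnt a l ≠ 0 →
    ∃ (v : RAAG Γ) (e : Bool), ∀ g, ∃ t, dl Γ a g l = ((eb Γ a (g * v) e : RAAG Γ ⧸ lk Γ a), e) :: t := by
  intro l
  induction l with
  | nil => intro h; exact absurd (cnt_nil a) h
  | cons x l ih =>
    obtain ⟨c, e⟩ := x
    intro h
    by_cases hc : c = a
    · subst hc
      refine ⟨1, e, fun g => ⟨dl Γ c (g * wd Γ [(c, e)]) l, ?_⟩⟩
      rw [dl, if_pos rfl, mul_one]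
    · rw [cnt_cons_ne hc] at h
      obtain ⟨v, e', hv⟩ := ih h
      refine ⟨wd Γ [(c, e)] * v, e', fun g => ?_⟩
      obtain ⟨t, ht⟩ := hv (g * wd Γ [(c, e)])
      exact ⟨t, by rw [dl, if_neg hc, ht, mul_assoc]⟩

theorem outside_letter {b g : RAAG Γ} {a c : A} (hbn : ∀ a, ∀ n : ℕ, al Γ a (b ^ n) = n * al Γ a b)
    (ha : al Γ a b = 0) (hc : 0 < al Γ c b) {m : ℕ} (hm : 0 < m) (hcm : b ^ m * g = g * b ^ m)
    {W : List (A × Bool)} (hW : Geo Γ W) (hWg : wd Γ W = g) (hcnt : cnt a W ≠ 0) : Γ.Adj a c := by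
  by_contra hadj
  have H := al_tree Γ c
  obtain ⟨v, e, hv⟩ := dl_first Γ W hcnt
  have key : ∀ j : ℕ, (j : ℤ) * al Γ c b ≤ 2 * al Γ c (eb Γ a v e) := by
    intro j
    have d1 : ∀ n, dd Γ a (b ^ n) = 1 := by
      intro n
      have : al Γ a (b ^ n) = 0 := by rw [hbn, ha, mul_zero]
      rw [al] at this
      exact FreeGroup.norm_eq_zero.1 (by exact_mod_cast this)
    have hcom : b ^ (m * j) * g = g * b ^ (m * j) := by
      rw [pow_mul]
      exact ((show Commute (b ^ m) g from hcm).pow_left j).eq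
    have d2 : act Γ a (b ^ (m * j)) (dd Γ a g) = act Γ a 1 (dd Γ a g) := by
      have := congrArg (dd Γ a) hcom
      rw [dd_mul, dd_mul, d1, one_mul, map_one, mul_one] at this
      rw [this, map_one]; rfl
    rw [← hWg, ← mk_dl, ← mk_dl] at d2
    have d3 := congrArg FreeGroup.toWord d2
    rw [FreeGroup.toWord_mk, FreeGroup.toWord_mk, (hW.red Γ _).reduce_eq, (hW.red Γ _).reduce_eq] at d3
    obtain ⟨t1, ht1⟩ := hv (b ^ (m * j))
    obtain ⟨t2, ht2⟩ := hv 1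
    rw [ht1, ht2, one_mul] at d3
    have d4 := congrArg Prod.fst (List.cons.inj d3).1
    have d5 : eb Γ a (b ^ (m * j) * v) e = b ^ (m * j) * eb Γ a v e := by
      cases e <;> simp [eb, mul_assoc]
    simp only at d4
    have d6 := QuotientGroup.eq.1 d4.symm
    have d7 := al_lk Γ hadj d6
    rw [d5] at d7
    set u := eb Γ a v e
    have d8 := H.mul_le (u * (u⁻¹ * (b ^ (m * j) * u))) u⁻¹
    have d9 := H.mul_le u (u⁻¹ * (b ^ (m * j) * u))
    rw [H.inv] at d8
    rw [show u * (u⁻¹ * (b ^ (m * j) * u)) * u⁻¹ = b ^ (m * j) by group, hbn] at d8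
    have : (j : ℤ) ≤ ((m * j : ℕ) : ℤ) := by
      exact_mod_cast Nat.le_mul_of_pos_left j hm
    nlinarith
  have k1 := key ((2 * al Γ c (eb Γ a v e)).toNat + 1)
  have := Int.self_le_toNat (2 * al Γ c (eb Γ a v e))
  push_cast at k1
  nlinarith

theorem ret_self {S : Set A} {l : List (A × Bool)} (h : ∀ a, cnt a l ≠ 0 → a ∈ S) :
    ret Γ S (wd Γ l) = wd Γ l := by
  induction l with
  | nil => rw [wd_nil, map_one]
  | cons x l ih =>
    obtain ⟨c, e⟩ := x
    rw [wd_cons, map_mul, ret_letter_mem Γ e (h c (by rw [cnt_cons_self]; omega)), ih]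
    intro a ha
    refine h a ?_
    by_cases hc : c = a
    · subst hc; rw [cnt_cons_self]; omega
    · rwa [cnt_cons_ne hc]

theorem letter_central {S : Set A} {a : A} (h : ∀ c ∈ S, Γ.Adj a c) (e : Bool) (x : RAAG Γ) :
    Commute (wd Γ [(a, e)]) (ret Γ S x) := by
  have h1 : Commute (raagGen Γ a) (ret Γ S x) := by
    obtain ⟨l, rfl⟩ := wd_surj Γ x
    induction l with
    | nil => rw [wd_nil, map_one]; exact Commute.one_right _
    | cons y l ih =>
      obtain ⟨c, e⟩ := y
      rw [wd_cons, map_mul]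
      refine Commute.mul_right ?_ ih
      by_cases hc : c ∈ S
      · rw [ret_letter_mem Γ e hc]
        have : Commute (raagGen Γ a) (raagGen Γ c) := gen_comm Γ (h c hc)
        cases e
        · rw [wd_false]; exact this.inv_right
        · rw [wd_true]; exact this
      · rw [ret_letter_not Γ e hc]; exact Commute.one_right _
  cases e
  · rw [wd_false]; exact h1.inv_left
  · rw [wd_true]; exact h1

theorem ret_split {S : Set A} {l : List (A × Bool)} (h : ∀ a, cnt a l ≠ 0 → a ∉ S → ∀ c ∈ S, Γ.Adj a c) :
    ∃ z, wd Γ l = ret Γ S (wd Γ l) * z ∧ ∀ x, Commute z (ret Γ S x) := by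
  induction l with
  | nil => exact ⟨1, by simp [wd_nil], fun x => Commute.one_left _⟩
  | cons y l ih =>
    obtain ⟨c, e⟩ := y
    obtain ⟨z, hz, hz2⟩ := ih (by
      intro a ha
      refine h a ?_
      by_cases hc : c = a
      · subst hc; rw [cnt_cons_self]; omega
      · rwa [cnt_cons_ne hc])
    by_cases hc : c ∈ S
    · refine ⟨z, ?_, hz2⟩
      rw [wd_cons, map_mul, ret_letter_mem Γ e hc, mul_assoc, ← hz]
    · have hcen := letter_central Γ (h c (by rw [cnt_cons_self]; omega) hc) e
      refine ⟨wd Γ [(c, e)] * z, ?_, fun x => (hcen x).mul_left (hz2 x)⟩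
      rw [wd_cons, map_mul, ret_letter_not Γ e hc, one_mul, ← mul_assoc, ← (hcen _).eq, mul_assoc, ← hz]

theorem ret_b {b : RAAG Γ} : ret Γ {a | 0 < al Γ a b} b = b := by
  obtain ⟨l, hl, hg⟩ := exists_geo Γ b
  conv_rhs => rw [← hl]
  rw [← ret_self Γ (S := {a | 0 < al Γ a b}) (l := l), hl]
  intro a ha
  show 0 < al Γ a b
  rw [← hl, hg.al]
  omega

theorem commute_of_pow {b g : RAAG Γ} (hbn : ∀ a, ∀ n : ℕ, al Γ a (b ^ n) = n * al Γ a b)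
    {m : ℕ} (hm : 0 < m) (hcm : b ^ m * g = g * b ^ m) : Commute b g := by
  set S : Set A := {a | 0 < al Γ a b} with hS
  have hb : ret Γ S b = b := ret_b Γ
  obtain ⟨W, hW, hg⟩ := exists_geo Γ g
  obtain ⟨z, hz, hz2⟩ := ret_split Γ (S := S) (l := W) (by
    intro a ha haS c hc
    refine outside_letter Γ hbn ?_ hc hm hcm hg hW ha
    have h1 : ¬ 0 < al Γ a b := haS
    have := (al_tree Γ a).nonneg b
    omega)
  rw [hW] at hz
  have hzb : Commute z b := by have := hz2 b; rwa [hb] at this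
  suffices h : Commute b (ret Γ S g) by
    rw [hz]; exact h.mul_right hzb.symm
  set γ := ret Γ S g with hγ
  have h1 : b ^ m * γ = γ * b ^ m := by
    have := congrArg (ret Γ S) hcm
    rwa [map_mul, map_mul, map_pow, hb] at this
  have h2 : (γ⁻¹ * b * γ) ^ m = b ^ m := by
    have := conj_pow (i := m) (a := γ⁻¹) (b := b)
    rw [inv_inv] at this
    rw [this, mul_assoc, h1]; group
  have h3 : b⁻¹ * (γ⁻¹ * b * γ) = 1 := by
    refine eq_one_of_al Γ fun a => ?_
    by_cases ha : 0 < al Γ a b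
    · exact (al_tree Γ a).root ha (hbn a) hm h2
    · have : b⁻¹ * (γ⁻¹ * b * γ) = ret Γ S (b⁻¹ * (g⁻¹ * b * g)) := by
        simp only [map_mul, map_inv, hb, hγ]
      rw [this]
      exact al_ret_not Γ (show a ∉ S from ha) _
  have h4 : γ⁻¹ * b * γ = b := by
    have := eq_of_inv_mul_eq_one h3
    exact this.symm
  show b * γ = γ * b
  calc b * γ = γ * (γ⁻¹ * b * γ) := by group
    _ = γ * b := by rw [h4]

theorem no_invert [Fintype A] {b g : RAAG Γ} (hbn : ∀ a, ∀ n : ℕ, al Γ a (b ^ n) = n * al Γ a b)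
    {a0 : A} (h0 : 0 < al Γ a0 b)
    {m : ℕ} (hm : 0 < m) (hcm : g * b ^ m * g⁻¹ = (b ^ m)⁻¹) : False := by
  set S : Set A := {a | 0 < al Γ a b} with hS
  have hb : ret Γ S b = b := ret_b Γ
  set γ := ret Γ S g with hγ
  have h1 : γ * b ^ m * γ⁻¹ = (b ^ m)⁻¹ := by
    have := congrArg (ret Γ S) hcm
    rwa [map_mul, map_mul, map_inv, map_inv, map_pow, hb] at this
  have h2 : γ * γ = 1 := by
    refine eq_one_of_al Γ fun a => ?_
    by_cases ha : 0 < al Γ a b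
    · exact (al_tree Γ a).invert ha (hbn a) hm h1
    · rw [hγ, ← map_mul]
      exact al_ret_not Γ (show a ∉ S from ha) _
  have h3 := raag_sq_eq_one Γ _ γ le_rfl h2
  rw [h3, one_mul, inv_one, mul_one] at h1
  have h4 : b ^ (m + m) = 1 := by
    rw [pow_add]; nth_rewrite 1 [h1]; group
  have h5 := hbn a0 (m + m)
  rw [h4, (al_tree Γ a0).one] at h5
  push_cast at h5
  have : (0 : ℤ) < m := by exact_mod_cast hm
  nlinarith

theorem supp_eq (b : RAAG Γ) : raagSupp Γ b = {a | 0 < al Γ a b} := by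
  ext a
  constructor
  · rintro ⟨l, h1, h2, h3⟩
    have h1 : wd Γ l = b := h1
    subst h1
    show 0 < al Γ a (wd Γ l)
    rw [(geo_of_len Γ h2).al]
    have : 0 < cnt a l := List.count_pos_iff.2 h3
    omega
  · intro h
    obtain ⟨l, rfl, h2⟩ := exists_len Γ b
    have h : 0 < al Γ a (wd Γ l) := h
    rw [(geo_of_len Γ h2).al] at h
    exact ⟨l, rfl, h2, List.count_pos_iff.1 (by change 0 < cnt a l; omega)⟩

theorem dichS [Fintype A] {b β β' g : RAAG Γ}
    (hconn : ((Γᶜ).induce {a | 0 < al Γ a b}).Connected)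
    (h1 : ∀ a, ∀ n : ℕ, al Γ a (β ^ n) = n * al Γ a b)
    (h2 : ∀ a, ∀ n : ℕ, al Γ a (β' ^ n) = n * al Γ a b)
    {a0 : A} (h0 : 0 < al Γ a0 b)
    (hno : ∀ m : ℕ, 0 < m → β ^ m * g ≠ g * β' ^ m) :
    ∃ K : ℤ, ∀ N M : ℕ, gp2 (al Γ a0) (g⁻¹ * β ^ N) (β' ^ M) ≤ K := by
  by_contra hK
  have prop : ∀ x y : {a | 0 < al Γ a b}, ((Γᶜ).induce {a | 0 < al Γ a b}).Walk x y →
      (∃ K : ℤ, ∀ N M : ℕ, gp2 (al Γ x) (g⁻¹ * β ^ N) (β' ^ M) ≤ K) →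
      (∃ K : ℤ, ∀ N M : ℕ, gp2 (al Γ y) (g⁻¹ * β ^ N) (β' ^ M) ≤ K) := by
    intro x y w
    induction w with
    | nil => exact id
    | cons h w ih =>
      rename_i u v _
      intro hx
      refine ih ?_
      have h' : u.1 ≠ v.1 ∧ ¬ Γ.Adj u.1 v.1 := by simpa [SimpleGraph.compl_adj] using h
      exact propagate Γ h'.1 (fun hh => h'.2 hh.symm) v.2 u.2 (h1 _) (h2 _) (h1 _) hx
  have all : ∀ a, ∀ N : ℕ, al Γ a ((β ^ N)⁻¹ * g * β' ^ N) ≤ 3 * al Γ a g := by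
    intro a N
    have H := al_tree Γ a
    by_cases ha : 0 < al Γ a b
    · have hc : ¬ ∃ K : ℤ, ∀ N M : ℕ, gp2 (al Γ a) (g⁻¹ * β ^ N) (β' ^ M) ≤ K := by
        intro hc
        obtain ⟨w⟩ := hconn.preconnected ⟨a, ha⟩ ⟨a0, h0⟩
        exact hK (prop ⟨a, ha⟩ ⟨a0, h0⟩ w hc)
      exact H.dich ha (h1 a) (h2 a) hc N
    · have hb0 : al Γ a b = 0 := le_antisymm (not_lt.1 ha) (H.nonneg b)
      have e1 := H.mul_le ((β ^ N)⁻¹ * g) (β' ^ N)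
      have e2 := H.mul_le (β ^ N)⁻¹ g
      rw [h2 a N, hb0] at e1
      rw [H.inv, h1 a N, hb0] at e2
      have := H.nonneg g
      linarith
  obtain ⟨m, hm, h⟩ := pigeon Γ (β := β) (β' := β') (g := g) (L := 3 * raagLen Γ g) (by
    intro N
    zify
    rw [len_eq_sum, len_eq_sum, Finset.mul_sum]
    exact Finset.sum_le_sum fun a _ => all a N)
  exact hno m hm h

theorem key_bound [Fintype A] {b g : RAAG Γ}
    (hconn : ((Γᶜ).induce {a | 0 < al Γ a b}).Connected)
    (hbn : ∀ a, ∀ n : ℕ, al Γ a (b ^ n) = n * al Γ a b)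
    {a0 : A} (h0 : 0 < al Γ a0 b) (hcom : ¬ Commute b g) :
    ∃ K : ℤ, ∀ N M : ℤ, gp2 (al Γ a0) (g⁻¹ * b ^ N) (b ^ M) ≤ K := by
  have hbi : ∀ a, ∀ n : ℕ, al Γ a (b⁻¹ ^ n) = n * al Γ a b := by
    intro a n; rw [inv_pow, (al_tree Γ a).inv, hbn]
  obtain ⟨K1, hK1⟩ := dichS Γ (g := g) hconn hbn hbn h0
    (fun m hm h => hcom (commute_of_pow Γ hbn hm h))
  obtain ⟨K2, hK2⟩ := dichS Γ (g := g) hconn hbi hbi h0 (fun m hm h => by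
    refine hcom (commute_of_pow Γ hbn hm ?_)
    rw [inv_pow] at h
    have h : Commute (b ^ m)⁻¹ g := h
    exact (Commute.inv_left_iff.1 h).eq)
  obtain ⟨K3, hK3⟩ := dichS Γ (g := g) hconn hbn hbi h0 (fun m hm h => by
    refine no_invert Γ (g := g) hbn h0 hm ?_
    rw [inv_pow] at h
    rw [← inv_inj]
    calc (g * b ^ m * g⁻¹)⁻¹ = (g * (b ^ m)⁻¹) * g⁻¹ := by group
      _ = (b ^ m)⁻¹⁻¹ := by rw [← h]; group)
  obtain ⟨K4, hK4⟩ := dichS Γ (g := g) hconn hbi hbn h0 (fun m hm h => by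
    refine no_invert Γ (g := g) hbn h0 hm ?_
    rw [inv_pow] at h
    rw [← h]; group)
  refine ⟨max (max K1 K2) (max K3 K4), fun N M => ?_⟩
  have hneg : ∀ n : ℕ, b ^ (-(n : ℤ)) = b⁻¹ ^ n := by intro n; simp
  obtain ⟨n, rfl | rfl⟩ := N.eq_nat_or_neg <;> obtain ⟨k, rfl | rfl⟩ := M.eq_nat_or_neg <;>
    simp only [hneg, zpow_natCast]
  · exact (hK1 n k).trans (by simp)
  · exact (hK3 n k).trans (by simp)
  · exact (hK4 n k).trans (by simp)
  · exact (hK2 n k).trans (by simp)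

theorem pingpong {b : RAAG Γ} {a0 : A} (h0 : 0 < al Γ a0 b)
    (hbn : ∀ n : ℕ, al Γ a0 (b ^ n) = n * al Γ a0 b) :
    ∀ (l : ℕ) (k : Fin (l + 1) → ℤ) (g : Fin (l + 1) → RAAG Γ), (∀ i, k i ≠ 0) →
    (∀ i : Fin (l + 1), (i : ℕ) + 1 < l + 1 →
      ∃ K : ℤ, ∀ N M : ℤ, gp2 (al Γ a0) ((g i)⁻¹ * b ^ N) (b ^ M) ≤ K) →
    ∀ B : ℤ, ∃ N0 : ℕ, ∀ n : ℕ, N0 < n →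
      B < gp2 (al Γ a0) ((b ^ n) ^ (k 0)) (List.ofFn fun i => (b ^ n) ^ (k i) * g i).prod := by
  have H := al_tree Γ a0
  have hz : ∀ (n : ℕ) (k : ℤ), k ≠ 0 → (n : ℤ) ≤ al Γ a0 ((b ^ n) ^ k) := by
    intro n k hk
    have : al Γ a0 ((b ^ n) ^ k) = n * (k.natAbs * al Γ a0 b) := by
      obtain ⟨j, rfl | rfl⟩ := k.eq_nat_or_neg
      · rw [zpow_natCast, ← pow_mul, hbn]; push_cast; simp; ring
      · rw [zpow_neg, zpow_natCast, H.inv, ← pow_mul, hbn]; push_cast; simp; ring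
    rw [this]
    have h1 : 1 ≤ k.natAbs := Nat.one_le_iff_ne_zero.2 (Int.natAbs_ne_zero.2 hk)
    have h2 : (1 : ℤ) ≤ k.natAbs * al Γ a0 b := by
      have : (1 : ℤ) ≤ k.natAbs := by exact_mod_cast h1
      nlinarith
    have h3 : (0 : ℤ) ≤ n := by positivity
    nlinarith
  intro l
  induction l with
  | zero =>
    intro k g hk _ B
    refine ⟨(B + 2 * al Γ a0 (g 0)).toNat, fun n hn => ?_⟩
    have h1 : B + 2 * al Γ a0 (g 0) < n := by omega
    have h2 := hz n (k 0) (hk 0)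
    simp only [List.ofFn_succ, List.ofFn_zero, List.prod_cons, List.prod_nil, mul_one]
    rw [TreeLen.gp_def, inv_mul_cancel_left]
    have h3 := H.le_left ((b ^ n) ^ k 0) (g 0)
    have h4 := H.nonneg (g 0)
    linarith
  | succ l ih =>
    intro k g hk hg B
    obtain ⟨K, hK⟩ := hg 0 (by simp)
    obtain ⟨N0, hN0⟩ := ih (fun i => k i.succ) (fun i => g i.succ) (fun i => hk _)
      (fun i hi => hg i.succ (by simpa using hi)) K
    refine ⟨max N0 (B + K + 2 * al Γ a0 (g 0)).toNat, fun n hn => ?_⟩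
    have hn1 := hN0 n (lt_of_le_of_lt (le_max_left _ _) hn)
    have hn2 : B + K + 2 * al Γ a0 (g 0) < n := by
      have := lt_of_le_of_lt (le_max_right _ _) hn
      omega
    rw [List.ofFn_succ, List.prod_cons]
    set Q := (List.ofFn fun i : Fin (l + 1) => (b ^ n) ^ (k i.succ) * g i.succ).prod with hQ
    have h2 := hz n (k 0) (hk 0)
    set x := (b ^ n) ^ k 0 with hx
    have hxi : x⁻¹ = b ^ (-(n * k 0)) := by rw [hx, zpow_neg, zpow_mul, zpow_natCast]
    have hy : (b ^ n) ^ (k (Fin.succ 0)) = b ^ (n * k (Fin.succ 0)) := by rw [zpow_mul, zpow_natCast]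
    have e1 := hK (-(n * k 0)) (n * k (Fin.succ 0))
    rw [← hxi, ← hy] at e1
    set y := (b ^ n) ^ (k (Fin.succ 0)) with hyd
    have e2 := H.gp_min ((g 0)⁻¹ * x⁻¹) Q y
    have e3 : gp2 (al Γ a0) Q y = gp2 (al Γ a0) y Q := by
      simp only [TreeLen.gp_def]; rw [H.symm Q y]; ring
    rw [e3] at e2
    have e4 : gp2 (al Γ a0) ((g 0)⁻¹ * x⁻¹) Q ≤ K := by
      rcases min_le_iff.1 e2 with h | h
      · exact h.trans e1
      · exact absurd hn1 (not_lt.2 (h.trans e1))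
    rw [TreeLen.gp_def, show ((g 0)⁻¹ * x⁻¹)⁻¹ * Q = x * g 0 * Q by group] at e4
    rw [TreeLen.gp_def, show x⁻¹ * (x * g 0 * Q) = g 0 * Q by group]
    have e5 := H.le_right (g 0)⁻¹ x⁻¹
    rw [H.inv, H.inv] at e5
    have e6 := H.mul_le (g 0) Q
    linarith

end KeyPart

/-- Big powers property: let `w = x^{k₁} g₁ x^{k₂} g₂ ⋯ x^{k_l} g_l ∈ 𝔾[x]` be nontrivial
with all `kᵢ` nonzero and all `gᵢ` nontrivial, and let `b` be a cyclically reduced block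
element with `[b, gᵢ] ≠ 1` for `i = 1, …, l−1`. Then there is `N` such that for all
`n > N` the homomorphism `φ_{b,n} : x ↦ bⁿ` maps `w` to a nontrivial element of `𝔾`. -/
theorem raag_big_powers {A : Type} [Fintype A] (Γ : SimpleGraph A)
    (l : ℕ) (k : Fin l → ℤ) (g : Fin l → RAAG Γ)
    (hk : ∀ i, k i ≠ 0) (hg : ∀ i, g i ≠ 1)
    (w : RAAGX Γ)
    (hw : w = (List.ofFn fun i => Xvar Γ ^ (k i) * Monoid.Coprod.inl (g i)).prod)
    (hwne : w ≠ 1)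
    (b : RAAG Γ) (hbc : CyclicallyReduced Γ b) (hbb : IsBlock Γ b)
    (hbg : ∀ i : Fin l, (i : ℕ) + 1 < l → ¬Commute b (g i)) :
    ∃ N : ℕ, ∀ n : ℕ, N < n → phiPow Γ b n w ≠ 1 := by
  classical
  have hsupp := supp_eq Γ b
  have hconn : ((Γᶜ).induce {a | 0 < al Γ a b}).Connected := by
    rw [← hsupp]; exact hbb
  obtain ⟨⟨a0, h0⟩⟩ := hconn.nonempty
  have h0 : 0 < al Γ a0 b := h0
  have hbb2 : ∀ a, al Γ a (b * b) = 2 * al Γ a b := by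
    have hle : ∀ a, al Γ a (b * b) ≤ 2 * al Γ a b := fun a => by
      have := (al_tree Γ a).mul_le b b
      linarith
    have hs : ∑ a, al Γ a (b * b) = ∑ a, 2 * al Γ a b := by
      rw [← Finset.mul_sum, ← len_eq_sum, ← len_eq_sum]
      exact_mod_cast hbc
    intro a
    exact (Finset.sum_eq_sum_iff_of_le (fun a _ => hle a)).1 hs a (Finset.mem_univ a)
  have hbn : ∀ a, ∀ n : ℕ, al Γ a (b ^ n) = n * al Γ a b :=
    fun a n => (al_tree Γ a).pow_eq b (hbb2 a) n
  rcases l with _ | l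
  · exact absurd (by simpa using hw) hwne
  obtain ⟨N0, hN0⟩ := pingpong Γ h0 (hbn a0) l k g hk
    (fun i hi => key_bound Γ hconn hbn h0 (hbg i hi)) 0
  refine ⟨N0, fun n hn h1 => ?_⟩
  have h2 := hN0 n hn
  have h3 : phiPow Γ b n w = (List.ofFn fun i => (b ^ n) ^ (k i) * g i).prod := by
    rw [hw, map_list_prod, List.map_ofFn]
    congr 2
    funext i
    simp [phiPow, Xvar]
  rw [← h3, h1, TreeLen.gp_def, mul_one, (al_tree Γ a0).inv, (al_tree Γ a0).one] at h2
  omega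
end
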